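/- arXiv:2105.08305 — 5 statements merged into one kernel-verified Lean document; each statement's English description precedes it below -/
import Mathlib

section
/- There exists δ ∈ (0, 1/4) such that, for the target shape P = (0,1)² \ ([1/4, 3/4] × [1/2 − δ, 1/2 + δ]) (a unit square with a thin rectangular slot removed), no finite sequence of snip and reset operations in the disconnected two-tool snip model leads from the initial configuration to a configuration in which T₁ and T₂ both realize P simultaneously. -/
open Set

/-- The plane. -/
abbrev Plane := ℝ × ℝ

/-- A rigid motion of the plane: `g x = R x + v` with `R ∈ SO(2)`. -/
def IsRigidMotion (g : Plane → Plane) : Prop :=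
  ∃ θ : ℝ, ∃ v : Plane, ∀ p : Plane,
    g p = (Real.cos θ * p.1 - Real.sin θ * p.2 + v.1,
           Real.sin θ * p.1 + Real.cos θ * p.2 + v.2)

/-- The open unit square `(0,1)²`. -/
def UnitSq : Set Plane := Ioo (0:ℝ) 1 ×ˢ Ioo (0:ℝ) 1

/-- A tool `T` realizes the shape `P` if `T` is the image of `P` under a rigid motion. -/
def Realizes (T P : Set Plane) : Prop := ∃ g, IsRigidMotion g ∧ T = g '' P

/-- One operation (snip or reset) in the disconnected two-tool snip model. -/
inductive DStep : Set Plane × Set Plane → Set Plane × Set Plane → Prop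
  | snip1 (g : Plane → Plane) (hg : IsRigidMotion g) (T₁ T₂ : Set Plane) :
      DStep (T₁, T₂) (T₁ \ closure (g '' T₂), T₂)
  | snip2 (g : Plane → Plane) (hg : IsRigidMotion g) (T₁ T₂ : Set Plane) :
      DStep (T₁, T₂) (T₁, T₂ \ closure (g '' T₁))
  | reset1 (T₁ T₂ : Set Plane) : DStep (T₁, T₂) (UnitSq, T₂)
  | reset2 (T₁ T₂ : Set Plane) : DStep (T₁, T₂) (T₁, UnitSq)

/-- `DReach k c c'` : configuration `c'` is reachable from `c` by exactly `k` operations. -/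
inductive DReach : ℕ → Set Plane × Set Plane → Set Plane × Set Plane → Prop
  | refl (c : Set Plane × Set Plane) : DReach 0 c c
  | step {k : ℕ} {c c' c'' : Set Plane × Set Plane} :
      DStep c c' → DReach k c' c'' → DReach (k + 1) c c''

/-- The unit square with the slot of half-width `1/8` removed. -/
def SlottedSq : Set Plane :=
  UnitSq \ (Icc (1/4 : ℝ) (3/4) ×ˢ Icc (1/2 - 1/8 : ℝ) (1/2 + 1/8))

/-- The squared Euclidean distance. -/
def sqDist (p q : Plane) : ℝ := (p.1 - q.1) ^ 2 + (p.2 - q.2) ^ 2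

lemma IsRigidMotion.continuous {g : Plane → Plane} (hg : IsRigidMotion g) : Continuous g := by
  obtain ⟨θ, v, h⟩ := hg
  rw [funext h]
  fun_prop

lemma IsRigidMotion.sqDist_eq {g : Plane → Plane} (hg : IsRigidMotion g) (p q : Plane) :
    sqDist (g p) (g q) = sqDist p q := by
  obtain ⟨θ, v, h⟩ := hg
  simp only [h, sqDist]
  linear_combination ((p.1 - q.1) ^ 2 + (p.2 - q.2) ^ 2) * Real.sin_sq_add_cos_sq θ

lemma IsRigidMotion.injective {g : Plane → Plane} (hg : IsRigidMotion g) :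
    Function.Injective g := by
  intro p q hpq
  have h := hg.sqDist_eq p q
  rw [hpq] at h
  simp only [sqDist, sub_self] at h
  ext <;> nlinarith [sq_nonneg (p.1 - q.1), sq_nonneg (p.2 - q.2)]

lemma mem_slottedSq {p : Plane} : p ∈ SlottedSq ↔
    (0 < p.1 ∧ p.1 < 1 ∧ 0 < p.2 ∧ p.2 < 1) ∧
      (p.1 < 1/4 ∨ 3/4 < p.1 ∨ p.2 < 3/8 ∨ 5/8 < p.2) := by
  simp only [SlottedSq, UnitSq, mem_sdiff, mem_prod, mem_Ioo, mem_Icc]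
  constructor
  · rintro ⟨⟨⟨h1, h2⟩, h3, h4⟩, h5⟩
    refine ⟨⟨h1, h2, h3, h4⟩, ?_⟩
    by_contra! h
    exact h5 ⟨⟨h.1, h.2.1⟩, by linarith, by linarith⟩
  · rintro ⟨⟨h1, h2, h3, h4⟩, h5⟩
    refine ⟨⟨⟨h1, h2⟩, h3, h4⟩, ?_⟩
    rintro ⟨⟨a, b⟩, c, d⟩
    rcases h5 with h | h | h | h <;> linarith

lemma isPreconnected_slottedSq : IsPreconnected SlottedSq := by
  have rect (a b c d : ℝ) : IsPreconnected (Ioo a b ×ˢ Ioo c d) :=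
    isPreconnected_Ioo.prod isPreconnected_Ioo
  have h := (((rect 0 (1/4) 0 1).union (1/8, 1/8) (by norm_num) (by norm_num)
    (rect 0 1 0 (3/8))).union (7/8, 1/8) (by norm_num) (by norm_num)
    (rect (3/4) 1 0 1)).union (7/8, 7/8) (by norm_num) (by norm_num)
    (rect 0 1 (5/8) 1)
  convert h using 1
  ext p
  simp only [mem_slottedSq, mem_union, mem_prod, mem_Ioo]
  constructor
  · rintro ⟨⟨h1, h2, h3, h4⟩, h5⟩
    simp only [h1, h2, h3, h4, true_and, and_true]
    tauto
  · rintro (((h | h) | h) | h) <;> obtain ⟨⟨h1, h2⟩, h3, h4⟩ := h <;>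
      refine ⟨⟨?_, ?_, ?_, ?_⟩, ?_⟩ <;> first | linarith | simp_all

/-- The segment from a corner of the square into it starts inside the slotted square, so that the
corner lies in the closure. -/
lemma corner_mem_closure_slottedSq {a b : ℝ} (ha : a = 0 ∨ a = 1) (hb : b = 0 ∨ b = 1) :
    ((a, b) : Plane) ∈ closure SlottedSq := by
  have hc : Continuous fun t : ℝ => ((a + t * (1 - 2 * a), b + t * (1 - 2 * b)) : Plane) := by
    fun_prop
  have h0 : (0 : ℝ) ∈ closure (Ioo (0 : ℝ) (1/8)) := by
    rw [closure_Ioo (by norm_num)]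
    norm_num
  have := hc.closure_preimage_subset SlottedSq (closure_mono (s := Ioo (0 : ℝ) (1/8)) ?_ h0)
  · simpa using this
  · rintro t ⟨h1, h2⟩
    rw [mem_preimage, mem_slottedSq]
    rcases ha with rfl | rfl <;> rcases hb with rfl | rfl <;>
      refine ⟨⟨?_, ?_, ?_, ?_⟩, ?_⟩ <;> norm_num <;> first | linarith | (left; linarith) |
        (right; left; linarith)

/-- A rigid motion mapping the slotted square into the unit square is a symmetry of the latter. -/
lemma IsRigidMotion.image_unitSq_eq {h : Plane → Plane} (hh : IsRigidMotion h)
    (hsub : h '' SlottedSq ⊆ UnitSq) : h '' UnitSq = UnitSq := by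
  have corner (a b : ℝ) (ha : a = 0 ∨ a = 1) (hb : b = 0 ∨ b = 1) :
      h (a, b) ∈ Icc (0 : ℝ) 1 ×ˢ Icc (0 : ℝ) 1 := by
    have h1 := closure_mono hsub (image_closure_subset_closure_image hh.continuous
      (mem_image_of_mem h (corner_mem_closure_slottedSq ha hb)))
    rwa [UnitSq, closure_prod_eq, closure_Ioo (by norm_num)] at h1
  obtain ⟨θ, v, hθ⟩ := hh
  have c00 := corner 0 0 (by simp) (by simp)
  have c01 := corner 0 1 (by simp) (by simp)
  have c10 := corner 1 0 (by simp) (by simp)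
  have c11 := corner 1 1 (by simp) (by simp)
  clear corner
  have hcs := Real.sin_sq_add_cos_sq θ
  generalize Real.sin θ = s at *
  generalize Real.cos θ = c at *
  obtain ⟨v1, v2⟩ := v
  simp only [hθ, mem_prod, mem_Icc, mul_zero, mul_one, zero_add, sub_zero, zero_sub, add_zero]
    at c00 c01 c10 c11
  have hprod : s * c = 0 := by
    apply le_antisymm
    · nlinarith [c00, c01, c10, c11]
    · nlinarith [c00, c01, c10, c11]
  have cases4 : (s = 0 ∧ c = 1 ∧ v1 = 0 ∧ v2 = 0) ∨ (s = 0 ∧ c = -1 ∧ v1 = 1 ∧ v2 = 1) ∨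
      (s = 1 ∧ c = 0 ∧ v1 = 1 ∧ v2 = 0) ∨ (s = -1 ∧ c = 0 ∧ v1 = 0 ∧ v2 = 1) := by
    rcases mul_eq_zero.mp hprod with h0 | h0
    · subst h0
      have : c = 1 ∨ c = -1 := by
        rw [← sq_eq_sq_iff_eq_or_eq_neg]
        linarith
      rcases this with rfl | rfl
      · left
        refine ⟨rfl, rfl, ?_, ?_⟩ <;> linarith
      · right; left
        refine ⟨rfl, rfl, ?_, ?_⟩ <;> linarith
    · subst h0
      have : s = 1 ∨ s = -1 := by
        rw [← sq_eq_sq_iff_eq_or_eq_neg]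
        linarith
      rcases this with rfl | rfl
      · right; right; left
        refine ⟨rfl, rfl, ?_, ?_⟩ <;> linarith
      · right; right; right
        refine ⟨rfl, rfl, ?_, ?_⟩ <;> linarith
  apply Subset.antisymm
  · rintro _ ⟨⟨x, y⟩, ⟨⟨h1, h2⟩, h3, h4⟩, rfl⟩
    simp only at h1 h2 h3 h4
    rcases cases4 with ⟨rfl, rfl, rfl, rfl⟩ | ⟨rfl, rfl, rfl, rfl⟩ | ⟨rfl, rfl, rfl, rfl⟩ |
      ⟨rfl, rfl, rfl, rfl⟩ <;> simp only [hθ, UnitSq, mem_prod, mem_Ioo] <;>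
      refine ⟨⟨?_, ?_⟩, ?_, ?_⟩ <;> linarith
  · rintro ⟨x, y⟩ ⟨⟨h1, h2⟩, h3, h4⟩
    simp only at h1 h2 h3 h4
    refine ⟨(c * (x - v1) + s * (y - v2), -s * (x - v1) + c * (y - v2)), ?_, ?_⟩
    · rcases cases4 with ⟨rfl, rfl, rfl, rfl⟩ | ⟨rfl, rfl, rfl, rfl⟩ | ⟨rfl, rfl, rfl, rfl⟩ |
        ⟨rfl, rfl, rfl, rfl⟩ <;> simp only [UnitSq, mem_prod, mem_Ioo] <;>
        refine ⟨⟨?_, ?_⟩, ?_, ?_⟩ <;> linarith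
    · rw [hθ]
      ext
      · simp only
        linear_combination (x - v1) * hcs
      · simp only
        linear_combination (y - v2) * hcs

lemma not_realizes_unitSq : ¬ Realizes UnitSq SlottedSq := by
  rintro ⟨h, hh, heq⟩
  have hsq := hh.image_unitSq_eq heq.symm.subset
  have hmem : ((1/2, 1/2) : Plane) ∈ UnitSq := by norm_num [UnitSq]
  have hc : h (1/2, 1/2) ∈ h '' SlottedSq := by
    rw [← heq, ← hsq]
    exact mem_image_of_mem h hmem
  rw [hh.injective.mem_set_image, mem_slottedSq] at hc
  norm_num at hc

/-- Cutting with a slotted square cannot produce a slotted square from anything else inside the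
unit square. -/
lemma realizes_of_realizes_snip {T U : Set Plane} {g : Plane → Plane} (hg : IsRigidMotion g)
    (hT : T ⊆ UnitSq) (hU : Realizes U SlottedSq)
    (h : Realizes (T \ closure (g '' U)) SlottedSq) : Realizes T SlottedSq := by
  by_contra hn
  obtain ⟨u, hu, rfl⟩ := hU
  obtain ⟨f, hf, heq⟩ := h
  have hsq := hf.image_unitSq_eq (heq ▸ sdiff_subset.trans hT)
  set A := closure (g '' (u '' SlottedSq)) with hA
  set K := f '' (Icc (1/4 : ℝ) (3/4) ×ˢ Icc (1/2 - 1/8 : ℝ) (1/2 + 1/8)) with hK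
  have hfP : f '' SlottedSq = UnitSq \ K := by
    rw [SlottedSq, image_sdiff hf.injective, hsq]
  have hKc : IsClosed K := ((isCompact_Icc.prod isCompact_Icc).image hf.continuous).isClosed
  have hdisj : ∀ x ∈ A, x ∈ UnitSq → x ∈ K := by
    intro x hxA hx
    by_contra hxK
    have : x ∈ T \ A := by
      rw [heq, hfP]
      exact ⟨hx, hxK⟩
    exact this.2 hxA
  obtain ⟨x, hxT, hxA⟩ : ∃ x ∈ T, x ∈ A := by
    by_contra! hno
    apply hn
    have hTA : T \ A = T := sdiff_eq_left.mpr (disjoint_left.mpr hno)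
    exact ⟨f, hf, hTA ▸ heq⟩
  have hAconn : IsPreconnected A :=
    ((isPreconnected_slottedSq.image u hu.continuous.continuousOn).image g
      hg.continuous.continuousOn).closure
  have hAsub : A ⊆ UnitSq := by
    by_contra hns
    obtain ⟨y, hyA, hy⟩ := not_subset.mp hns
    have hKsub : K ⊆ UnitSq := by
      rw [hK, ← hsq]
      apply image_mono
      exact prod_mono (Icc_subset_Ioo (by norm_num) (by norm_num))
        (Icc_subset_Ioo (by norm_num) (by norm_num))
    obtain ⟨z, hzA, hz1, hz2⟩ := hAconn UnitSq Kᶜ (isOpen_Ioo.prod isOpen_Ioo) hKc.isOpen_compl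
      (fun z hz => by
        by_cases hzs : z ∈ UnitSq
        · exact Or.inl hzs
        · exact Or.inr fun hzK => hzs (hKsub hzK))
      ⟨x, hxA, hT hxT⟩ ⟨y, hyA, fun hyK => hy (hKsub hyK)⟩
    exact hz2 (hdisj z hzA hz1)
  have hAK {p : Plane} (hp : p ∈ SlottedSq) : g (u p) ∈ K := by
    have : g (u p) ∈ A := subset_closure (mem_image_of_mem g (mem_image_of_mem u hp))
    exact hdisj _ this (hAsub this)
  obtain ⟨a, ⟨⟨a1, a2⟩, a3, a4⟩, ha⟩ :=
    hAK (p := (1/8, 1/8)) (mem_slottedSq.mpr (by norm_num))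
  obtain ⟨b, ⟨⟨b1, b2⟩, b3, b4⟩, hb⟩ :=
    hAK (p := (7/8, 7/8)) (mem_slottedSq.mpr (by norm_num))
  have hd := hf.sqDist_eq a b
  rw [ha, hb, hg.sqDist_eq, hu.sqDist_eq] at hd
  have hx : (a.1 - b.1) ^ 2 ≤ (1/2) ^ 2 := sq_le_sq' (by linarith) (by linarith)
  have hy : (a.2 - b.2) ^ 2 ≤ (1/4) ^ 2 := sq_le_sq' (by linarith) (by linarith)
  norm_num [sqDist] at hd hx hy
  linarith

lemma DReach.not_both_realize {k : ℕ} {c c' : Set Plane × Set Plane} (hr : DReach k c c')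
    (h1 : c.1 ⊆ UnitSq) (h2 : c.2 ⊆ UnitSq)
    (hn : ¬ (Realizes c.1 SlottedSq ∧ Realizes c.2 SlottedSq)) :
    ¬ (Realizes c'.1 SlottedSq ∧ Realizes c'.2 SlottedSq) := by
  induction hr with
  | refl c => exact hn
  | step hs _ ih =>
    cases hs with
    | snip1 g hg T₁ T₂ =>
      exact ih (sdiff_subset.trans h1) h2
        fun h => hn ⟨realizes_of_realizes_snip hg h1 h.2 h.1, h.2⟩
    | snip2 g hg T₁ T₂ =>
      exact ih h1 (sdiff_subset.trans h2)
        fun h => hn ⟨h.1, realizes_of_realizes_snip hg h2 h.1 h.2⟩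
    | reset1 T₁ T₂ => exact ih Subset.rfl h2 fun h => not_realizes_unitSq h.1
    | reset2 T₁ T₂ => exact ih h1 Subset.rfl fun h => not_realizes_unitSq h.2

theorem stmt0 :
    ∃ δ : ℝ, δ ∈ Ioo (0:ℝ) (1/4) ∧
      ∀ (k : ℕ) (T₁ T₂ : Set Plane),
        DReach k (UnitSq, UnitSq) (T₁, T₂) →
        ¬ (Realizes T₁
              (UnitSq \ (Icc (1/4 : ℝ) (3/4) ×ˢ Icc (1/2 - δ) (1/2 + δ))) ∧
           Realizes T₂
              (UnitSq \ (Icc (1/4 : ℝ) (3/4) ×ˢ Icc (1/2 - δ) (1/2 + δ)))) := by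
  refine ⟨1/8, by norm_num, fun k T₁ T₂ hr => ?_⟩
  exact hr.not_both_realize Subset.rfl Subset.rfl fun h => not_realizes_unitSq h.1
end

section
/- Let n ≥ 1 and let Δ₁, …, Δ_n be pairwise disjoint closed triangles, each with nonempty interior, all contained in the open unit square (0,1)², and let P = (0,1)² \ (Δ₁ ∪ … ∪ Δ_n). Then every finite sequence of snip, reset and undo operations in the connected two-tool snip model (with an undo stack of any size k ≥ 0) that leads from the initial configuration to a configuration in which T₁ realizes P contains at least n snip operations. -/
open Set

/-- A configuration of the two-tool model with undo stacks: each tool has a current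
shape and a stack (list) of its most recent previous shapes. -/
structure UConfig where
  T₁ : Set Plane
  S₁ : List (Set Plane)
  T₂ : Set Plane
  S₂ : List (Set Plane)

/-- A snip operation in the connected two-tool model with undo stacks of size `k`:
a snip replaces a tool by a connected component of the result of the cut, pushing
the replaced shape onto that tool's stack. -/
inductive CUSnip (k : ℕ) : UConfig → UConfig → Prop
  | snip1 (g : Plane → Plane) (hg : IsRigidMotion g) (c : UConfig) (x : Plane)
      (hx : x ∈ c.T₁ \ closure (g '' c.T₂)) :
      CUSnip k c ⟨connectedComponentIn (c.T₁ \ closure (g '' c.T₂)) x,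
        List.take k (c.T₁ :: c.S₁), c.T₂, c.S₂⟩
  | snip2 (g : Plane → Plane) (hg : IsRigidMotion g) (c : UConfig) (x : Plane)
      (hx : x ∈ c.T₂ \ closure (g '' c.T₁)) :
      CUSnip k c ⟨c.T₁, c.S₁, connectedComponentIn (c.T₂ \ closure (g '' c.T₁)) x,
        List.take k (c.T₂ :: c.S₂)⟩

/-- A reset or undo operation in the connected two-tool model with undo stacks of
size `k`. -/
inductive CUAux (k : ℕ) : UConfig → UConfig → Prop
  | reset1 (c : UConfig) : CUAux k c ⟨UnitSq, List.take k (c.T₁ :: c.S₁), c.T₂, c.S₂⟩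
  | reset2 (c : UConfig) : CUAux k c ⟨c.T₁, c.S₁, UnitSq, List.take k (c.T₂ :: c.S₂)⟩
  | undo1 (P : Set Plane) (rest : List (Set Plane)) (T₂ : Set Plane)
      (S₂ : List (Set Plane)) (T₁ : Set Plane) :
      CUAux k ⟨T₁, P :: rest, T₂, S₂⟩ ⟨P, rest, T₂, S₂⟩
  | undo2 (P : Set Plane) (rest : List (Set Plane)) (T₁ : Set Plane)
      (S₁ : List (Set Plane)) (T₂ : Set Plane) :
      CUAux k ⟨T₁, S₁, T₂, P :: rest⟩ ⟨T₁, S₁, P, rest⟩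

/-- `CUReach k s c c'` : in the connected model with undo stacks of size `k`,
configuration `c'` is reachable from `c` by a finite sequence of snip, reset and
undo operations containing exactly `s` snip operations. -/
inductive CUReach (k : ℕ) : ℕ → UConfig → UConfig → Prop
  | refl (c : UConfig) : CUReach k 0 c c
  | snip {s : ℕ} {c c' c'' : UConfig} :
      CUSnip k c c' → CUReach k s c' c'' → CUReach k (s + 1) c c''
  | aux {s : ℕ} {c c' c'' : UConfig} :
      CUAux k c c' → CUReach k s c' c'' → CUReach k s c c''

/-- `A` is a union of `m` preconnected (possibly empty) sets. -/
def PreconnectedCover (m : ℕ) (A : Set Plane) : Prop :=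
  ∃ f : Fin m → Set Plane, (∀ i, IsPreconnected (f i)) ∧ A = ⋃ i, f i

lemma PreconnectedCover.union {m : ℕ} {A C : Set Plane} (h : PreconnectedCover m A)
    (hC : IsPreconnected C) : PreconnectedCover (m + 1) (A ∪ C) := by
  obtain ⟨f, hf, rfl⟩ := h
  refine ⟨Fin.cons C f, fun i => ?_, ?_⟩
  · refine Fin.cases ?_ (fun j => ?_) i
    · simpa using hC
    · simpa using hf j
  · ext x
    simp [or_comm]

lemma PreconnectedCover.succ {m : ℕ} {A : Set Plane} (h : PreconnectedCover m A) :
    PreconnectedCover (m + 1) A := by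
  simpa using h.union isPreconnected_empty

/-- Attaching connected sets that meet `A` does not increase the number of pieces. -/
lemma PreconnectedCover.attach {m : ℕ} {A B : Set Plane} (h : PreconnectedCover m A)
    (hAB : A ⊆ B)
    (hB : ∀ y ∈ B \ A, ∃ V ⊆ B, IsPreconnected V ∧ y ∈ V ∧ (V ∩ A).Nonempty) :
    PreconnectedCover m B := by
  obtain ⟨f, hf, rfl⟩ := h
  refine ⟨fun i => ⋃₀ {W | W ⊆ B ∧ IsPreconnected W ∧ f i ⊆ W ∧ (f i).Nonempty},
    fun i => ?_, ?_⟩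
  · rcases (f i).eq_empty_or_nonempty with he | ⟨x, hx⟩
    · simp [he, isPreconnected_empty]
    · exact isPreconnected_sUnion x _ (fun W hW => hW.2.2.1 hx) (fun W hW => hW.2.1)
  · apply Subset.antisymm
    · intro y hy
      rw [mem_iUnion]
      by_cases hyA : y ∈ ⋃ i, f i
      · obtain ⟨i, hi⟩ := mem_iUnion.1 hyA
        exact ⟨i, f i, ⟨(subset_iUnion f i).trans hAB, hf i, subset_rfl, ⟨y, hi⟩⟩, hi⟩
      · obtain ⟨V, hVB, hV, hyV, z, hzV, hz⟩ := hB y ⟨hy, hyA⟩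
        obtain ⟨i, hi⟩ := mem_iUnion.1 hz
        exact ⟨i, f i ∪ V, ⟨union_subset ((subset_iUnion f i).trans hAB) hVB,
          (hf i).union z hi hzV hV, subset_union_left, ⟨z, hi⟩⟩, Or.inr hyV⟩
    · exact iUnion_subset fun i => sUnion_subset fun W hW => hW.1

lemma PreconnectedCover.image {m : ℕ} {A : Set Plane} (h : PreconnectedCover m A)
    {g : Plane → Plane} (hg : Continuous g) : PreconnectedCover m (g '' A) := by
  obtain ⟨f, hf, rfl⟩ := h
  exact ⟨fun i => g '' f i, fun i => (hf i).image g hg.continuousOn, image_iUnion⟩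

/-- A union of finitely many disjoint nonempty closed sets needs at least as many
preconnected pieces. -/
lemma PreconnectedCover.card_le {m : ℕ} {ι : Type*} [Fintype ι] {F : ι → Set Plane}
    (h : PreconnectedCover m (⋃ i, F i)) (hcl : ∀ i, IsClosed (F i))
    (hne : ∀ i, (F i).Nonempty) (hdisj : ∀ i j, i ≠ j → Disjoint (F i) (F j)) :
    Fintype.card ι ≤ m := by
  obtain ⟨f, hf, hA⟩ := h
  choose x hx using hne
  have hmem : ∀ i, ∃ j, x i ∈ f j := fun i =>
    mem_iUnion.1 (hA ▸ mem_iUnion.2 ⟨i, hx i⟩)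
  choose σ hσ using hmem
  have hinj : Function.Injective σ := by
    intro i j hij
    by_contra hne
    have hcl' : IsClosed (⋃ l : {l // l ≠ i}, F l) :=
      isClosed_iUnion_of_finite fun l => hcl l
    obtain ⟨z, -, hz, hz'⟩ := isPreconnected_closed_iff.1 (hf (σ i)) (F i) _ (hcl i) hcl'
      (fun z hz => by
        obtain ⟨l, hl⟩ := mem_iUnion.1 (hA ▸ mem_iUnion.2 ⟨σ i, hz⟩ : z ∈ ⋃ i, F i)
        by_cases hli : l = i
        · exact Or.inl (hli ▸ hl)
        · exact Or.inr (mem_iUnion.2 ⟨⟨l, hli⟩, hl⟩))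
      ⟨x i, hσ i, hx i⟩
      ⟨x j, hij ▸ hσ j, mem_iUnion.2 ⟨⟨j, fun h => hne h.symm⟩, hx j⟩⟩
    obtain ⟨l, hl⟩ := mem_iUnion.1 hz'
    exact disjoint_left.1 (hdisj i l fun h => l.2 h.symm) hz hl
  simpa using Fintype.card_le_of_injective σ hinj

lemma IsRigidMotion.exists_inverse {g : Plane → Plane} (hg : IsRigidMotion g) :
    ∃ g', Continuous g' ∧ Function.LeftInverse g' g ∧ Function.RightInverse g' g := by
  obtain ⟨θ, v, h⟩ := hg
  have hsc := Real.sin_sq_add_cos_sq θ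
  refine ⟨fun p => (Real.cos θ * (p.1 - v.1) + Real.sin θ * (p.2 - v.2),
    -Real.sin θ * (p.1 - v.1) + Real.cos θ * (p.2 - v.2)), by fun_prop,
    fun p => ?_, fun p => ?_⟩
  · rw [h]
    ext
    · dsimp only
      linear_combination p.1 * hsc
    · dsimp only
      linear_combination p.2 * hsc
  · rw [h]
    ext
    · dsimp only
      linear_combination (p.1 - v.1) * hsc
    · dsimp only
      linear_combination (p.2 - v.2) * hsc

lemma isOpen_unitSq : IsOpen UnitSq := isOpen_Ioo.prod isOpen_Ioo

lemma isPreconnected_unitSq : IsPreconnected UnitSq :=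
  isPreconnected_Ioo.prod isPreconnected_Ioo

lemma isPreconnected_compl_unitSq : IsPreconnected UnitSqᶜ := by
  have h : UnitSqᶜ = ((Iic 0 ×ˢ univ ∪ univ ×ˢ Iic 0) ∪ Ici 1 ×ˢ univ) ∪
      (univ ×ˢ Ici 1 : Set Plane) := by
    ext ⟨x, y⟩
    simp only [UnitSq, mem_compl_iff, mem_prod, mem_Ioo, mem_union, mem_Iic, mem_Ici,
      mem_univ, and_true, true_and]
    grind
  rw [h]
  refine IsPreconnected.union (0, 1) (by simp) (by simp)
    (IsPreconnected.union (1, 0) (by simp) (by simp)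
      (IsPreconnected.union (0, 0) (by simp) (by simp) ?_ ?_) ?_) ?_
  · exact isPreconnected_Iic.prod isPreconnected_univ
  · exact isPreconnected_univ.prod isPreconnected_Iic
  · exact isPreconnected_Ici.prod isPreconnected_univ
  · exact isPreconnected_univ.prod isPreconnected_Ici

/-- A connected open tool inside the unit square whose complement is a union of `m`
preconnected sets. -/
structure GoodTool (m : ℕ) (T : Set Plane) : Prop where
  isOpen : IsOpen T
  isPreconnected : IsPreconnected T
  subset : T ⊆ UnitSq
  cover : PreconnectedCover m Tᶜ

lemma GoodTool.succ {m : ℕ} {T : Set Plane} (h : GoodTool m T) : GoodTool (m + 1) T :=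
  ⟨h.isOpen, h.isPreconnected, h.subset, h.cover.succ⟩

lemma goodTool_unitSq {m : ℕ} (hm : 1 ≤ m) : GoodTool m UnitSq := by
  refine ⟨isOpen_unitSq, isPreconnected_unitSq, subset_rfl, ?_⟩
  induction m, hm using Nat.le_induction with
  | base => exact ⟨fun _ => UnitSqᶜ, fun _ => isPreconnected_compl_unitSq, (iUnion_const _).symm⟩
  | succ m _ ih => exact ih.succ

lemma GoodTool.component_sdiff {m : ℕ} {T C : Set Plane} (h : GoodTool m T)
    (hC : IsPreconnected C) (hcl : IsClosed C) (x : Plane) :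
    GoodTool (m + 1) (connectedComponentIn (T \ C) x) := by
  have hU : IsOpen (T \ C) := h.isOpen.sdiff hcl
  refine ⟨hU.connectedComponentIn, isPreconnected_connectedComponentIn,
    (connectedComponentIn_subset _ _).trans (sdiff_subset.trans h.subset), ?_⟩
  have hcov : PreconnectedCover (m + 1) (T \ C)ᶜ := by
    have := h.cover.union hC
    rwa [show Tᶜ ∪ C = (T \ C)ᶜ by ext; simp [imp_iff_not_or]] at this
  refine hcov.attach (compl_subset_compl.2 (connectedComponentIn_subset _ _)) ?_
  rintro y ⟨hyK, hyU⟩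
  rw [notMem_compl_iff] at hyU
  set V := connectedComponentIn (T \ C) y with hV
  have hVo : IsOpen V := hU.connectedComponentIn
  have hyV : y ∈ V := mem_connectedComponentIn hyU
  have hVp : IsPreconnected (closure V) := isPreconnected_connectedComponentIn.closure
  refine ⟨closure V, ?_, hVp, subset_closure hyV, ?_⟩
  · refine Disjoint.subset_compl_right (Disjoint.closure_left ?_ hU.connectedComponentIn)
    refine disjoint_left.2 fun z hz hz' => hyK ?_
    rw [connectedComponentIn_eq hz', ← connectedComponentIn_eq hz]
    exact hyV
  · by_contra hne
    have hsub : closure V ⊆ T \ C := by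
      intro z hz
      by_contra hzU
      exact hne ⟨z, hz, hzU⟩
    have hclosed : IsClosed V := closure_eq_iff_isClosed.1
      ((hVp.subset_connectedComponentIn (subset_closure hyV) hsub).antisymm subset_closure)
    have huniv : V = univ := IsClopen.eq_univ ⟨hclosed, hVo⟩ ⟨y, hyV⟩
    have h0 : ((0, 0) : Plane) ∈ UnitSq :=
      h.subset (connectedComponentIn_subset _ y (huniv ▸ mem_univ _)).1
    simp [UnitSq] at h0

/-- Every current or stacked shape of the configuration is a good tool. -/
structure UConfig.Good (m : ℕ) (c : UConfig) : Prop where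
  tool₁ : GoodTool m c.T₁
  stack₁ : ∀ T ∈ c.S₁, GoodTool m T
  tool₂ : GoodTool m c.T₂
  stack₂ : ∀ T ∈ c.S₂, GoodTool m T

lemma forall_mem_take_cons {m k : ℕ} {T : Set Plane} {S : List (Set Plane)}
    (hT : GoodTool m T) (hS : ∀ T ∈ S, GoodTool m T) :
    ∀ T' ∈ List.take k (T :: S), GoodTool m T' := fun T' h => by
  rcases List.mem_cons.1 (List.mem_of_mem_take h) with rfl | h
  · exact hT
  · exact hS _ h

lemma UConfig.Good.succ {m : ℕ} {c : UConfig} (h : c.Good m) : c.Good (m + 1) :=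
  ⟨h.tool₁.succ, fun T hT => (h.stack₁ T hT).succ, h.tool₂.succ,
    fun T hT => (h.stack₂ T hT).succ⟩

lemma CUSnip.good {m k : ℕ} {c c' : UConfig} (h : CUSnip k c c') (hc : c.Good m) :
    c'.Good (m + 1) := by
  have hs := hc.succ
  cases h with
  | snip1 g hg c x hx =>
    exact ⟨hc.tool₁.component_sdiff (hc.tool₂.isPreconnected.image g
      hg.continuous.continuousOn).closure isClosed_closure x,
      forall_mem_take_cons hs.tool₁ hs.stack₁, hs.tool₂, hs.stack₂⟩
  | snip2 g hg c x hx =>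
    exact ⟨hs.tool₁, hs.stack₁, hc.tool₂.component_sdiff (hc.tool₁.isPreconnected.image g
      hg.continuous.continuousOn).closure isClosed_closure x,
      forall_mem_take_cons hs.tool₂ hs.stack₂⟩

lemma CUAux.good {m k : ℕ} (hm : 1 ≤ m) {c c' : UConfig} (h : CUAux k c c')
    (hc : c.Good m) : c'.Good m := by
  obtain ⟨h₁, h₁', h₂, h₂'⟩ := hc
  cases h with
  | reset1 => exact ⟨goodTool_unitSq hm, forall_mem_take_cons h₁ h₁', h₂, h₂'⟩
  | reset2 => exact ⟨h₁, h₁', goodTool_unitSq hm, forall_mem_take_cons h₂ h₂'⟩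
  | undo1 P rest =>
    exact ⟨h₁' _ List.mem_cons_self, fun T hT => h₁' T (List.mem_cons_of_mem _ hT), h₂, h₂'⟩
  | undo2 P rest =>
    exact ⟨h₁, h₁', h₂' _ List.mem_cons_self, fun T hT => h₂' T (List.mem_cons_of_mem _ hT)⟩

lemma CUReach.good {k s : ℕ} {c c' : UConfig} (h : CUReach k s c c') :
    ∀ {m : ℕ}, 1 ≤ m → c.Good m → c'.Good (m + s) := by
  induction h with
  | refl c => exact fun _ hc => hc
  | @snip s c c' c'' hsnip _ ih =>
    intro m hm hc
    have := ih (by omega : 1 ≤ m + 1) (hsnip.good hc)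
    rwa [show m + 1 + s = m + (s + 1) by omega] at this
  | aux haux _ ih => exact fun hm hc => ih hm (haux.good hm hc)

theorem stmt2 (n : ℕ) (hn : 1 ≤ n) (Δ : Fin n → Set Plane)
    (htri : ∀ i, ∃ a b c : Plane, Δ i = convexHull ℝ {a, b, c})
    (hint : ∀ i, (interior (Δ i)).Nonempty)
    (hdisj : ∀ i j, i ≠ j → Disjoint (Δ i) (Δ j))
    (hsub : ∀ i, Δ i ⊆ UnitSq)
    (k : ℕ) (s : ℕ) (c : UConfig)
    (hreach : CUReach k s ⟨UnitSq, [], UnitSq, []⟩ c)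
    (hreal : Realizes c.T₁ (UnitSq \ ⋃ i, Δ i)) :
    n ≤ s := by
  have hgood : c.Good (1 + s) := hreach.good le_rfl
    ⟨goodTool_unitSq le_rfl, by simp, goodTool_unitSq le_rfl, by simp⟩
  obtain ⟨g, hg, hT⟩ := hreal
  obtain ⟨g', hg', hl, hr⟩ := hg.exists_inverse
  have hcov := hgood.tool₁.cover.image hg'
  let F : Option (Fin n) → Set Plane := fun o => o.elim UnitSqᶜ Δ
  have hF : g' '' c.T₁ᶜ = ⋃ o, F o := by
    rw [hT, image_eq_preimage_of_inverse hr hl, preimage_compl, preimage_image_eq _ hl.injective,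
      iUnion_option]
    ext x
    simp [F, imp_iff_not_or]
  rw [hF] at hcov
  have hcard := hcov.card_le (fun o => ?_) (fun o => ?_) (fun i j hij => ?_)
  · simp only [Fintype.card_option, Fintype.card_fin] at hcard
    omega
  · cases o with
    | none => exact isOpen_unitSq.isClosed_compl
    | some i =>
      obtain ⟨p, q, r, h⟩ := htri i
      change IsClosed (Δ i)
      rw [h]
      exact (Set.toFinite {p, q, r}).isClosed_convexHull (𝕜 := ℝ)
  · cases o with
    | none => exact ⟨(0, 0), by simp [F, UnitSq]⟩
    | some i => exact (hint i).mono interior_subset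
  · cases i with
    | none =>
      cases j with
      | none => exact absurd rfl hij
      | some j => exact (disjoint_compl_right_iff_subset.2 (hsub j)).symm
    | some i =>
      cases j with
      | none => exact disjoint_compl_right_iff_subset.2 (hsub i)
      | some j => exact hdisj i j fun h => hij (h ▸ rfl)
end

section
/- For every positive integer n and every ε ∈ (0,1) there exists M₀ such that for every integer M ≥ M₀ the following holds: let 𝒯 be the (finite, nonempty) set of all 1D tools of the form ⋃_{i=1}^n (a_i, b_i) where a₁, b₁, …, a_n, b_n are integers with 0 ≤ a₁ < b₁ < a₂ < b₂ < … < a_n < b_n ≤ M. Then the number of tools in 𝒯 that are buildable in at most 2n − 1 operations in the 1D snip model starting from the single tool (0, M) is at most ε times the cardinality of 𝒯. -/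
open Set

/-- `Snip1DSeq M create` : the tools `create 0, create 1, …` are created in order in
the 1D snip model starting from the single tool `(0, M)`: each created tool is
obtained from two already-existing tools `T` and `U` by choosing a sign `σ` and an
offset `x` and forming `U \ closure {σ·t + x : t ∈ T}`. -/
def Snip1DSeq (M : ℝ) (j : ℕ) (create : Fin j → Set ℝ) : Prop :=
  ∀ ℓ : Fin j, ∃ T U : Set ℝ,
    (T = Ioo 0 M ∨ ∃ i : Fin j, i < ℓ ∧ T = create i) ∧
    (U = Ioo 0 M ∨ ∃ i : Fin j, i < ℓ ∧ U = create i) ∧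
    ∃ σ ∈ ({1, -1} : Set ℝ), ∃ x : ℝ,
      create ℓ = U \ closure ((fun t => σ * t + x) '' T)

/-- A 1D tool is buildable in at most `k` operations (starting from `(0, M)`). -/
def Buildable1D (M : ℝ) (k : ℕ) (S : Set ℝ) : Prop :=
  ∃ j : ℕ, j ≤ k ∧ ∃ create : Fin j → Set ℝ, Snip1DSeq M j create ∧
    (S = Ioo 0 M ∨ ∃ ℓ : Fin j, S = create ℓ)

/-- The set of all 1D tools consisting of `n` disjoint open intervals with integer
endpoints `0 ≤ a₁ < b₁ < a₂ < b₂ < … < a_n < b_n ≤ M`. -/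
def Tools1D (n M : ℕ) : Set (Set ℝ) :=
  {S | ∃ a b : Fin n → ℤ,
    (∀ i, 0 ≤ a i) ∧ (∀ i, a i < b i) ∧ (∀ i, b i ≤ (M : ℤ)) ∧
    (∀ i j : Fin n, i < j → b i < a j) ∧
    S = ⋃ i, Ioo ((a i : ℝ)) ((b i : ℝ))}

lemma mem_frontier_snip {T U : Set ℝ} {σ x p : ℝ} (hσ : σ ≠ 0)
    (hp : p ∈ frontier (U \ closure ((fun t => σ * t + x) '' T))) :
    p ∈ frontier U ∨ ∃ t ∈ frontier T, p = σ * t + x := by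
  rw [sdiff_eq] at hp
  rcases frontier_inter_subset _ _ hp with h | h
  · exact Or.inl h.1
  · right
    have h2 := h.2
    rw [frontier_compl] at h2
    have h3 := frontier_closure_subset h2
    have e := ((Homeomorph.mulLeft₀ σ hσ).trans (Homeomorph.addRight x)).image_frontier T
    have e2 : ⇑((Homeomorph.mulLeft₀ σ hσ).trans (Homeomorph.addRight x)) =
        fun t => σ * t + x := by
      ext t; simp
    rw [e2] at e
    rw [← e] at h3
    obtain ⟨t, ht, rfl⟩ := h3
    exact ⟨t, ht, rfl⟩

lemma frontier_Ioo_signed {M : ℝ} (hM : 0 < M) {p : ℝ} (hp : p ∈ frontier (Ioo 0 M)) :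
    ∃ c : SignType, p = c * M := by
  rw [frontier_Ioo hM] at hp
  rcases hp with rfl | rfl
  · exact ⟨0, by simp⟩
  · exact ⟨1, by simp⟩

/-- Every frontier point of a created tool is a combination of `M` and the offsets with
coefficients in `{-1, 0, 1}`. -/
lemma Snip1DSeq.exists_offsets {M : ℝ} (hM : 0 < M) {j k : ℕ} (hjk : j ≤ k)
    {create : Fin j → Set ℝ} (h : Snip1DSeq M j create) :
    ∃ x : Fin k → ℝ, ∀ ℓ : Fin j, ∀ p ∈ frontier (create ℓ),
      ∃ (c : SignType) (v : Fin k → SignType), (∀ i : Fin k, (ℓ : ℕ) < i → v i = 0) ∧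
        p = c * M + ∑ i, (v i : ℝ) * x i := by
  choose T U hT hU σ hσ y hy using h
  refine ⟨fun i => if hi : (i : ℕ) < j then y ⟨i, hi⟩ else 0, ?_⟩
  intro ℓ
  induction ℓ using WellFoundedLT.induction with
  | ind ℓ ih =>
    set x : Fin k → ℝ := fun i => if hi : (i : ℕ) < j then y ⟨i, hi⟩ else 0 with hx
    have old : ∀ V : Set ℝ, (V = Ioo 0 M ∨ ∃ i : Fin j, i < ℓ ∧ V = create i) →
        ∀ p ∈ frontier V, ∃ (c : SignType) (v : Fin k → SignType),
          (∀ i : Fin k, (ℓ : ℕ) ≤ i → v i = 0) ∧ p = c * M + ∑ i, (v i : ℝ) * x i := by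
      rintro V (rfl | ⟨i, hi, rfl⟩) p hp
      · obtain ⟨c, rfl⟩ := frontier_Ioo_signed hM hp
        exact ⟨c, 0, by simp⟩
      · obtain ⟨c, v, hv, e⟩ := ih i hi p hp
        exact ⟨c, v, fun i' hi' => hv i' (lt_of_lt_of_le hi hi'), e⟩
    have hσ' : ∃ s : SignType, σ ℓ = s ∧ s ≠ 0 := by
      rcases hσ ℓ with e | e
      · exact ⟨1, by simp [e], by decide⟩
      · rw [mem_singleton_iff] at e
        exact ⟨-1, by simp [e], by decide⟩
    obtain ⟨s, hs, hs0⟩ := hσ'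
    have hσ0 : σ ℓ ≠ 0 := by
      rcases hσ ℓ with e | e
      · simp [e]
      · rw [mem_singleton_iff] at e
        simp [e]
    intro p hp
    rw [hy ℓ] at hp
    rcases mem_frontier_snip hσ0 hp with hp | ⟨t, ht, rfl⟩
    · obtain ⟨c, v, hv, e⟩ := old _ (hU ℓ) p hp
      exact ⟨c, v, fun i hi => hv i hi.le, e⟩
    · obtain ⟨c, v, hv, rfl⟩ := old _ (hT ℓ) t ht
      set m : Fin k := Fin.castLE hjk ℓ with hm
      refine ⟨s * c, fun i => if i = m then 1 else s * v i, ?_, ?_⟩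
      · intro i hi
        have : i ≠ m := by
          rintro rfl
          simp [hm] at hi
        simp [this, hv i hi.le]
      · have hxm : x m = y ℓ := by simp [hx, hm]
        have key : ∀ i, (((if i = m then 1 else s * v i : SignType) : SignType) : ℝ) * x i =
            s * ((v i : ℝ) * x i) + if i = m then y ℓ else 0 := by
          intro i
          split_ifs with him
          · subst him
            rw [hv m (by simp [hm]), hxm]
            simp
          · simp [SignType.coe_mul, mul_assoc]
        simp only [key, Finset.sum_add_distrib, ← Finset.mul_sum, hs, SignType.coe_mul]
        simp
        ring

lemma Buildable1D.exists_offsets {M : ℝ} (hM : 0 < M) {k : ℕ} {S : Set ℝ}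
    (h : Buildable1D M k S) :
    ∃ x : Fin k → ℝ, ∀ p ∈ frontier S, ∃ (c : SignType) (v : Fin k → SignType),
      p = c * M + ∑ i, (v i : ℝ) * x i := by
  obtain ⟨j, hj, create, hc, hS⟩ := h
  obtain ⟨x, hx⟩ := hc.exists_offsets hM hj
  refine ⟨x, fun p hp => ?_⟩
  rcases hS with rfl | ⟨ℓ, rfl⟩
  · obtain ⟨c, rfl⟩ := frontier_Ioo_signed hM hp
    exact ⟨c, 0, by simp⟩
  · obtain ⟨c, v, -, e⟩ := hx ℓ p hp
    exact ⟨c, v, e⟩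

/-- A family of more linear forms than variables satisfies a nontrivial linear relation. -/
lemma exists_linear_relation {ι κ : Type*} [Fintype ι] [Fintype κ]
    (hcard : Fintype.card κ < Fintype.card ι) (A : ι → κ → ℝ) :
    ∃ w : ι → ℝ, w ≠ 0 ∧ ∀ x : κ → ℝ, ∑ i, w i * ∑ l, A i l * x l = 0 := by
  have hdep : ¬ LinearIndependent ℝ A := fun h => by
    have := h.fintype_card_le_finrank
    simp at this
    omega
  obtain ⟨w, hw, i, hi⟩ := Fintype.not_linearIndependent_iff.1 hdep
  refine ⟨w, fun e => hi (by simp [e]), fun x => ?_⟩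
  have hw' : ∀ l, ∑ i, w i * A i l = 0 := fun l => by
    simpa using congrFun hw l
  simp only [Finset.mul_sum]
  rw [Finset.sum_comm]
  refine Finset.sum_eq_zero fun l _ => ?_
  simp only [← mul_assoc, ← Finset.sum_mul, hw' l, zero_mul]

/-- A hyperplane contains at most `(M + 1) ^ (d - 1)` integer points of the cube `[0, M] ^ d`. -/
lemma card_hyperplane_le {ι : Type*} [Fintype ι] [DecidableEq ι] {w : ι → ℝ} (hw : w ≠ 0)
    (r : ℝ) (M : ℕ) :
    Nat.card {p : ι → Fin (M + 1) // ∑ i, w i * ((p i : ℕ) : ℝ) = r} ≤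
      (M + 1) ^ (Fintype.card ι - 1) := by
  obtain ⟨i₀, hi₀⟩ := Function.ne_iff.1 hw
  have hinj : Function.Injective
      (fun (p : {p : ι → Fin (M + 1) // ∑ i, w i * ((p i : ℕ) : ℝ) = r})
        (i : {i // i ≠ i₀}) => p.1 i) := by
    rintro ⟨p, hp⟩ ⟨q, hq⟩ hpq
    have hne : ∀ i, i ≠ i₀ → p i = q i := fun i hi => congrFun hpq ⟨i, hi⟩
    have hsum := hp.trans hq.symm
    rw [← Finset.add_sum_erase _ _ (Finset.mem_univ i₀),
      ← Finset.add_sum_erase _ (fun i => w i * ((q i : ℕ) : ℝ)) (Finset.mem_univ i₀),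
      Finset.sum_congr rfl (fun i hi => by rw [hne i (Finset.ne_of_mem_erase hi)]),
      add_left_inj] at hsum
    have h0 : p i₀ = q i₀ := by
      have := mul_left_cancel₀ hi₀ hsum
      exact Fin.ext (by exact_mod_cast this)
    refine Subtype.ext (funext fun i => ?_)
    by_cases h : i = i₀
    · rw [h]
      exact h0
    · exact hne i h
  have := Nat.card_le_card_of_injective _ hinj
  simpa [Nat.card_eq_fintype_card, Fintype.card_subtype_compl] using this

/-- The union of the intervals whose left and right endpoints are listed by `p`. -/
def toolOf {n : ℕ} (p : Fin n ⊕ Fin n → ℤ) : Set ℝ :=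
  ⋃ i, Ioo (p (Sum.inl i) : ℝ) (p (Sum.inr i))

/-- The endpoint lists of the tools in `Tools1D n M`. -/
def IsEndpointList {n : ℕ} (M : ℕ) (p : Fin n ⊕ Fin n → ℤ) : Prop :=
  (∀ i, 0 ≤ p (Sum.inl i)) ∧ (∀ i, p (Sum.inl i) < p (Sum.inr i)) ∧
    (∀ i, p (Sum.inr i) ≤ (M : ℤ)) ∧ ∀ i j : Fin n, i < j → p (Sum.inr i) < p (Sum.inl j)

lemma Tools1D_eq_image (n M : ℕ) :
    Tools1D n M = toolOf '' {p : Fin n ⊕ Fin n → ℤ | IsEndpointList M p} := by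
  ext S
  constructor
  · rintro ⟨a, b, h1, h2, h3, h4, rfl⟩
    exact ⟨Sum.elim a b, ⟨h1, h2, h3, h4⟩, rfl⟩
  · rintro ⟨p, ⟨h1, h2, h3, h4⟩, rfl⟩
    exact ⟨p ∘ Sum.inl, p ∘ Sum.inr, h1, h2, h3, h4, rfl⟩

lemma IsEndpointList.mem_Icc {n M : ℕ} {p : Fin n ⊕ Fin n → ℤ} (hp : IsEndpointList M p)
    (i : Fin n ⊕ Fin n) : 0 ≤ p i ∧ p i ≤ M := by
  obtain ⟨h1, h2, h3, -⟩ := hp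
  rcases i with i | i
  · exact ⟨h1 i, (h2 i).le.trans (h3 i)⟩
  · exact ⟨(h1 i).trans (h2 i).le, h3 i⟩

lemma frontier_toolOf_subset {n : ℕ} (p : Fin n ⊕ Fin n → ℤ)
    (hp : ∀ i, p (Sum.inl i) < p (Sum.inr i)) {y : ℝ} (hy : y ∈ frontier (toolOf p)) :
    ∃ i, y = p i := by
  have hopen : IsOpen (toolOf p) := isOpen_iUnion fun _ => isOpen_Ioo
  rw [hopen.frontier_eq, toolOf, closure_iUnion_of_finite] at hy
  obtain ⟨hy, hy'⟩ := hy
  obtain ⟨i, hi⟩ := mem_iUnion.1 hy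
  have hlt : (p (Sum.inl i) : ℝ) < p (Sum.inr i) := by exact_mod_cast hp i
  rw [closure_Ioo hlt.ne] at hi
  have hni : y ∉ Ioo (p (Sum.inl i) : ℝ) (p (Sum.inr i)) := fun h => hy' (mem_iUnion.2 ⟨i, h⟩)
  rcases hi.1.eq_or_lt with h | h
  · exact ⟨_, h.symm⟩
  rcases hi.2.eq_or_lt with h' | h'
  · exact ⟨_, h'⟩
  · exact absurd ⟨h, h'⟩ hni

lemma IsEndpointList.mem_frontier {n M : ℕ} {p : Fin n ⊕ Fin n → ℤ} (hp : IsEndpointList M p)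
    (i : Fin n ⊕ Fin n) : (p i : ℝ) ∈ frontier (toolOf p) := by
  have hopen : IsOpen (toolOf p) := isOpen_iUnion fun _ => isOpen_Ioo
  obtain ⟨-, h2, -, h4⟩ := hp
  rw [hopen.frontier_eq, toolOf, closure_iUnion_of_finite]
  refine ⟨?_, ?_⟩
  · rcases i with i | i <;> refine mem_iUnion.2 ⟨i, ?_⟩ <;>
    · have hlt : (p (Sum.inl i) : ℝ) < p (Sum.inr i) := by exact_mod_cast h2 i
      rw [closure_Ioo hlt.ne]
      simp [hlt.le]
  · intro hmem
    obtain ⟨j, hj1, hj2⟩ := mem_iUnion.1 hmem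
    norm_cast at hj1 hj2
    rcases i with i | i <;> rcases lt_trichotomy i j with h | h | h
    · have := h4 i j h; have := h2 i; omega
    · subst h; omega
    · have := h4 j i h; omega
    · have := h4 i j h; omega
    · subst h; omega
    · have := h4 j i h; have := h2 i; omega

lemma finite_Tools1D (n M : ℕ) : (Tools1D n M).Finite := by
  rw [Tools1D_eq_image]
  refine Set.Finite.image _ ((Set.Finite.pi' fun _ => finite_Icc (0 : ℤ) M).subset ?_)
  exact fun p hp i => hp.mem_Icc i

/-- `Tools1D n M` contains at least `q ^ (2 n)` tools as soon as `2 n q ≤ M + 1`. -/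
lemma pow_le_ncard_Tools1D {n M q : ℕ} (hq : 2 * n * q ≤ M + 1) :
    q ^ (2 * n) ≤ (Tools1D n M).ncard := by
  let pos : Fin n ⊕ Fin n → ℕ := Sum.elim (fun i => 2 * i) (fun i => 2 * i + 1)
  have pos_inj : ∀ i j, pos i = pos j → i = j := by
    rintro (i | i) (j | j) h <;> simp [pos] at h ⊢ <;> omega
  let f : (Fin n ⊕ Fin n → Fin q) → Fin n ⊕ Fin n → ℤ := fun g i => pos i * q + (g i : ℕ)
  have f_lt : ∀ (g : Fin n ⊕ Fin n → Fin q) (i j), pos i < pos j → f g i < f g j := by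
    intro g i j hij
    have h1 : (pos i + 1) * q ≤ pos j * q := Nat.mul_le_mul_right _ hij
    have h2 := (g i).2
    have : pos i * q + (g i : ℕ) < pos j * q + (g j : ℕ) := by linarith [Nat.zero_le (g j : ℕ)]
    simp only [f]
    exact_mod_cast this
  have hf : ∀ g, IsEndpointList M (f g) := by
    intro g
    refine ⟨fun i => ?_, fun i => f_lt _ _ _ ?_, fun i => ?_, fun i j hij => f_lt _ _ _ ?_⟩
    · simp only [f]; positivity
    · simp [pos]
    · have h1 : (2 * (i : ℕ) + 1 + 1) * q ≤ 2 * n * q := Nat.mul_le_mul_right _ (by omega)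
      have h2 := (g (Sum.inr i)).2
      have : (2 * (i : ℕ) + 1) * q + (g (Sum.inr i) : ℕ) ≤ M := by linarith
      simp only [f, pos, Sum.elim_inr]
      exact_mod_cast this
    · have : (i : ℕ) < j := hij
      simp only [pos, Sum.elim_inr, Sum.elim_inl]
      omega
  have hinj : Function.Injective fun g : Fin n ⊕ Fin n → Fin q => toolOf (f g) := by
    intro g g' hgg
    funext i
    have hi := (hf g).mem_frontier i
    rw [show toolOf (f g) = toolOf (f g') from hgg] at hi
    obtain ⟨j, hj⟩ := frontier_toolOf_subset _ (hf g').2.1 hi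
    have hj' : pos i * q + (g i : ℕ) = pos j * q + (g' j : ℕ) := by
      simp only [f] at hj
      exact_mod_cast hj
    have hij : i = j := by
      apply pos_inj
      have h0 : 0 < q := (g i).pos
      have h1 := congrArg (· / q) hj'
      simpa [mul_comm _ q, Nat.mul_add_div h0, Nat.div_eq_of_lt] using h1
    subst hij
    exact Fin.ext (by omega)
  calc q ^ (2 * n) = Nat.card (Fin n ⊕ Fin n → Fin q) := by
        simp [two_mul]
    _ = (range fun g : Fin n ⊕ Fin n → Fin q => toolOf (f g)).ncard := by
        rw [← Set.image_univ, Set.ncard_image_of_injective _ hinj, Set.ncard_univ]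
    _ ≤ (Tools1D n M).ncard := by
        refine Set.ncard_le_ncard ?_ (finite_Tools1D n M)
        rintro _ ⟨g, rfl⟩
        rw [Tools1D_eq_image]
        exact ⟨f g, hf g, rfl⟩

/-- At most `C (M + 1) ^ (2 n - 1)` tools are buildable in fewer than `2 n` operations, with `C`
independent of `M`. -/
lemma exists_ncard_buildable_le (n : ℕ) (hn : 1 ≤ n) :
    ∃ C : ℕ, ∀ M : ℕ, 0 < M →
      {S ∈ Tools1D n M | Buildable1D (M : ℝ) (2 * n - 1) S}.ncard ≤
        C * (M + 1) ^ (2 * n - 1) := by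
  have hcard : Fintype.card (Fin (2 * n - 1)) < Fintype.card (Fin n ⊕ Fin n) := by
    simp; omega
  choose w hw0 hw using fun A : Fin n ⊕ Fin n → Fin (2 * n - 1) → SignType =>
    exists_linear_relation hcard fun i l => (A i l : ℝ)
  let Idx := (Fin n ⊕ Fin n → Fin (2 * n - 1) → SignType) × (Fin n ⊕ Fin n → SignType)
  refine ⟨Fintype.card Idx, fun M hM => ?_⟩
  let H : Idx → Set (Fin n ⊕ Fin n → Fin (M + 1)) := fun a =>
    {p | ∑ i, w a.1 i * ((p i : ℕ) : ℝ) = ∑ i, w a.1 i * ((a.2 i : ℝ) * M)}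
  let t : (Fin n ⊕ Fin n → Fin (M + 1)) → Set ℝ := fun p => toolOf fun i => ((p i : ℕ) : ℤ)
  have hsub : {S ∈ Tools1D n M | Buildable1D (M : ℝ) (2 * n - 1) S} ⊆ t '' ⋃ a, H a := by
    rintro S ⟨hS, hB⟩
    rw [Tools1D_eq_image] at hS
    obtain ⟨p, hp, rfl⟩ := hS
    obtain ⟨x, hx⟩ := hB.exists_offsets (by exact_mod_cast hM)
    choose c A hcA using fun i => hx _ (hp.mem_frontier i)
    let g : Fin n ⊕ Fin n → Fin (M + 1) := fun i =>
      ⟨(p i).toNat, by have := hp.mem_Icc i; omega⟩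
    have hg : ∀ i, (((g i : ℕ) : ℤ)) = p i := fun i => Int.toNat_of_nonneg (hp.mem_Icc i).1
    refine ⟨g, mem_iUnion.2 ⟨(A, c), ?_⟩, by simp only [t, hg]⟩
    have hg' : ∀ i, ((g i : ℕ) : ℝ) = p i := fun i => by exact_mod_cast hg i
    simp only [H, mem_ofPred_eq, hg', hcA, mul_add, Finset.sum_add_distrib]
    rw [hw A x, add_zero]
  calc _ ≤ (t '' ⋃ a, H a).ncard := Set.ncard_le_ncard hsub (Set.toFinite _)
    _ ≤ (⋃ a, H a).ncard := Set.ncard_image_le (Set.toFinite _)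
    _ ≤ ∑ a, (H a).ncard := Set.ncard_iUnion_le_of_fintype _
    _ ≤ ∑ _a : Idx, (M + 1) ^ (2 * n - 1) := Finset.sum_le_sum fun a _ => by
        have := card_hyperplane_le (hw0 a.1) (∑ i, w a.1 i * ((a.2 i : ℝ) * M)) M
        simp only [Fintype.card_sum, Fintype.card_fin, ← two_mul] at this
        exact this
    _ = _ := by simp

theorem stmt3 (n : ℕ) (hn : 1 ≤ n) (ε : ℝ) (hε : ε ∈ Ioo (0:ℝ) 1) :
    ∃ M₀ : ℕ, ∀ M : ℕ, M₀ ≤ M →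
      (({S ∈ Tools1D n M | Buildable1D (M : ℝ) (2 * n - 1) S}.ncard : ℝ)) ≤
        ε * (Tools1D n M).ncard := by
  obtain ⟨C, hC⟩ := exists_ncard_buildable_le n hn
  obtain ⟨hε0, -⟩ := hε
  obtain ⟨K, hK⟩ := exists_nat_ge ((C * (4 * n : ℝ) ^ (2 * n)) / ε)
  refine ⟨max K (2 * n), fun M hM => ?_⟩
  have hMK : K ≤ M := (le_max_left _ _).trans hM
  have hMn : 2 * n ≤ M := (le_max_right _ _).trans hM
  have h1 := hC M (by omega)
  set q := (M + 1) / (2 * n) with hq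
  have h2 := pow_le_ncard_Tools1D (n := n) (M := M) (q := q) (Nat.mul_div_le _ _)
  have hq1 : 1 ≤ q := (Nat.one_le_div_iff (by omega)).2 (by omega)
  have hlt : M + 1 < 2 * n * (q + 1) := Nat.lt_mul_div_succ _ (by omega)
  have h4 : M + 1 ≤ 4 * n * q := by nlinarith
  have h5 : ((M : ℝ) + 1) ^ (2 * n) ≤ (4 * n : ℝ) ^ (2 * n) * q ^ (2 * n) := by
    rw [← mul_pow]
    exact pow_le_pow_left₀ (by positivity) (by exact_mod_cast h4) _
  have h6 : C * (4 * n : ℝ) ^ (2 * n) ≤ ε * (M + 1) := by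
    have : (K : ℝ) ≤ M := by exact_mod_cast hMK
    rw [div_le_iff₀ hε0] at hK
    nlinarith
  have hD : 0 < (4 * n : ℝ) ^ (2 * n) := by positivity
  have h7 : (C : ℝ) * ((M : ℝ) + 1) ^ (2 * n - 1) ≤ ε * (q : ℝ) ^ (2 * n) := by
    refine le_of_mul_le_mul_left ?_ hD
    calc (4 * n : ℝ) ^ (2 * n) * (C * ((M : ℝ) + 1) ^ (2 * n - 1))
        = (C * (4 * n : ℝ) ^ (2 * n)) * ((M : ℝ) + 1) ^ (2 * n - 1) := by ring
      _ ≤ (ε * (M + 1)) * ((M : ℝ) + 1) ^ (2 * n - 1) := by gcongr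
      _ = ε * ((M : ℝ) + 1) ^ (2 * n) := by
          rw [mul_assoc, ← pow_succ', Nat.sub_add_cancel (by omega)]
      _ ≤ ε * ((4 * n : ℝ) ^ (2 * n) * q ^ (2 * n)) := by gcongr
      _ = _ := by ring
  calc _ ≤ (C : ℝ) * ((M : ℝ) + 1) ^ (2 * n - 1) := by exact_mod_cast h1
    _ ≤ ε * (q : ℝ) ^ (2 * n) := h7
    _ ≤ _ := by
      gcongr
      exact_mod_cast h2
end

section
/- In the 1D snip model starting from the single tool (0, x₀), suppose tools T⁽¹⁾, …, T⁽ᵏ⁾ are created in order, where for each ℓ the tool T⁽ℓ⁾ = U \ closure({σ_ℓ·t + x_ℓ : t ∈ T}) for some tools T, U already present before step ℓ, some sign σ_ℓ ∈ {+1, −1} and some offset x_ℓ ∈ ℝ. Then for every ℓ ≤ k, every point of the frontier of T⁽ℓ⁾ is of the form ∑_{i=0}^{ℓ} ε_i x_i with coefficients ε_i ∈ {−1, 0, 1}. -/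
open Set

/-- A signed sum over an initial segment, times a sign and shifted by a multiple of a later term,
is again a signed sum. -/
lemma exists_signed_sum_extend (x : ℕ → ℝ) {m n : ℕ} (hmn : m < n) {ε : ℕ → ℝ}
    (hε : ∀ i, ε i ∈ ({-1, 0, 1} : Set ℝ)) {σ c : ℝ} (hσ : σ ∈ ({1, -1} : Set ℝ))
    (hc : c ∈ ({-1, 0, 1} : Set ℝ)) :
    ∃ δ : ℕ → ℝ, (∀ i, δ i ∈ ({-1, 0, 1} : Set ℝ)) ∧
      σ * (∑ i ∈ Finset.range (m + 1), ε i * x i) + c * x n =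
        ∑ i ∈ Finset.range (n + 1), δ i * x i := by
  refine ⟨fun i => if i ≤ m then σ * ε i else if i = n then c else 0, fun i => ?_, ?_⟩
  · dsimp only
    split_ifs
    · rcases hσ with rfl | rfl <;> rcases hε i with h | h | h <;> rw [h] <;> norm_num
    · exact hc
    · simp
  · beta_reduce
    rw [Finset.sum_range_succ _ n, if_neg (not_le.2 hmn), if_pos rfl, Finset.mul_sum]
    congr 1
    rw [← Finset.sum_subset (Finset.range_subset_range.2 (Nat.succ_le_of_lt hmn))]
    · refine Finset.sum_congr rfl fun i hi => ?_
      rw [if_pos (by simpa [Nat.lt_succ_iff] using hi), mul_assoc]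
    · intro i hi hi'
      rw [Finset.mem_range] at hi hi'
      rw [if_neg (by omega), if_neg (by omega), zero_mul]

lemma frontier_image_affine {σ : ℝ} (hσ : σ ≠ 0) (c : ℝ) (s : Set ℝ) :
    frontier ((fun t => σ * t + c) '' s) = (fun t => σ * t + c) '' frontier s :=
  (((Homeomorph.mulLeft₀ σ hσ).trans (Homeomorph.addRight c)).image_frontier s).symm

lemma frontier_diff_closure_subset {X : Type*} [TopologicalSpace X] (s t : Set X) :
    frontier (s \ closure t) ⊆ frontier s ∪ frontier t := by
  rw [sdiff_eq]
  refine (frontier_inter_subset _ _).trans (union_subset_union inter_subset_left ?_)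
  rw [frontier_compl]
  exact inter_subset_right.trans frontier_closure_subset

theorem stmt4 (k : ℕ) (x : ℕ → ℝ) (T : ℕ → Set ℝ)
    (hT0 : T 0 = Ioo 0 (x 0))
    (hstep : ∀ ℓ : ℕ, 1 ≤ ℓ → ℓ ≤ k →
      ∃ i j : ℕ, i < ℓ ∧ j < ℓ ∧ ∃ σ ∈ ({1, -1} : Set ℝ),
        T ℓ = T j \ closure ((fun t => σ * t + x ℓ) '' T i)) :
    ∀ ℓ : ℕ, ℓ ≤ k → ∀ y ∈ frontier (T ℓ),
      ∃ ε : ℕ → ℝ, (∀ i, ε i ∈ ({-1, 0, 1} : Set ℝ)) ∧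
        y = ∑ i ∈ Finset.range (ℓ + 1), ε i * x i := by
  intro ℓ
  induction ℓ using Nat.strong_induction_on with
  | _ ℓ ih =>
    intro hℓ y hy
    rcases Nat.eq_zero_or_pos ℓ with rfl | hpos
    · rw [hT0] at hy
      rcases lt_or_ge 0 (x 0) with h0 | h0
      · rw [frontier_Ioo h0] at hy
        rcases hy with rfl | rfl
        · exact ⟨fun _ => 0, by simp, by simp⟩
        · exact ⟨fun _ => 1, by simp, by simp⟩
      · simp [Ioo_eq_empty (not_lt.2 h0)] at hy
    · obtain ⟨i, j, hi, hj, σ, hσ, hT⟩ := hstep ℓ hpos hℓ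
      have hσ0 : σ ≠ 0 := by rcases hσ with rfl | rfl <;> norm_num
      rw [hT] at hy
      rcases frontier_diff_closure_subset _ _ hy with hy | hy
      · obtain ⟨ε, hε, rfl⟩ := ih j hj (hj.le.trans hℓ) y hy
        simpa using exists_signed_sum_extend x hj hε (σ := 1) (c := 0) (by simp) (by simp)
      · rw [frontier_image_affine hσ0] at hy
        obtain ⟨t, ht, rfl⟩ := hy
        obtain ⟨ε, hε, rfl⟩ := ih i hi (hi.le.trans hℓ) t ht
        simpa using exists_signed_sum_extend x hi hε hσ (c := 1) (by simp)
end

section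
/- There is a constant C such that for every n ≥ 1 and every polygonal domain P with n edges satisfying P ⊆ (0,1)², there is a finite sequence of at most C·n² snip and reset operations in the disconnected two-tool snip model leading from the initial configuration to a configuration in which T₁ realizes P. -/
open Set

/-- A polygonal domain with `n` edges: a nonempty bounded regular-open set whose
frontier is contained in a union of `n` closed line segments. -/
def IsPolygonalDomain (P : Set Plane) (n : ℕ) : Prop :=
  P.Nonempty ∧ Bornology.IsBounded P ∧ P = interior (closure P) ∧
  ∃ s : Fin n → Plane × Plane, frontier P ⊆ ⋃ i, segment ℝ (s i).1 (s i).2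

/-- The rigid motion with rotation angle `θ` and translation vector `v`, as a homeomorphism. -/
noncomputable def rigidHomeo (θ : ℝ) (v : Plane) : Plane ≃ₜ Plane where
  toFun p := (Real.cos θ * p.1 - Real.sin θ * p.2 + v.1,
    Real.sin θ * p.1 + Real.cos θ * p.2 + v.2)
  invFun w := (Real.cos θ * (w.1 - v.1) + Real.sin θ * (w.2 - v.2),
    -Real.sin θ * (w.1 - v.1) + Real.cos θ * (w.2 - v.2))
  left_inv p := by
    have h := Real.sin_sq_add_cos_sq θ
    ext
    · simp only
      linear_combination p.1 * h
    · simp only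
      linear_combination p.2 * h
  right_inv w := by
    have h := Real.sin_sq_add_cos_sq θ
    ext
    · simp only
      linear_combination (w.1 - v.1) * h
    · simp only
      linear_combination (w.2 - v.2) * h
  continuous_toFun := by fun_prop
  continuous_invFun := by fun_prop

lemma isRigidMotion_rigidHomeo (θ : ℝ) (v : Plane) : IsRigidMotion (rigidHomeo θ v) :=
  ⟨θ, v, fun _ => rfl⟩

lemma isRigidMotion_rigidHomeo_symm (θ : ℝ) (v : Plane) :
    IsRigidMotion (rigidHomeo θ v).symm := by
  refine ⟨-θ, (-(Real.cos θ * v.1 + Real.sin θ * v.2), Real.sin θ * v.1 - Real.cos θ * v.2),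
    fun p => ?_⟩
  change (Real.cos θ * (p.1 - v.1) + Real.sin θ * (p.2 - v.2),
    -Real.sin θ * (p.1 - v.1) + Real.cos θ * (p.2 - v.2)) = _
  rw [Real.cos_neg, Real.sin_neg]
  ext <;> simp only <;> ring

lemma IsRigidMotion.exists_rigidHomeo {g : Plane → Plane} (hg : IsRigidMotion g) :
    ∃ θ v, g = rigidHomeo θ v := by
  obtain ⟨θ, v, h⟩ := hg
  exact ⟨θ, v, funext h⟩

lemma IsRigidMotion.comp {f g : Plane → Plane} (hf : IsRigidMotion f) (hg : IsRigidMotion g) :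
    IsRigidMotion (f ∘ g) := by
  obtain ⟨θ, v, hf⟩ := hf
  obtain ⟨η, w, hg⟩ := hg
  refine ⟨θ + η, (Real.cos θ * w.1 - Real.sin θ * w.2 + v.1,
    Real.sin θ * w.1 + Real.cos θ * w.2 + v.2), fun p => ?_⟩
  rw [Function.comp_apply, hg, hf, Real.cos_add, Real.sin_add]
  ext <;> simp only <;> ring

lemma isRigidMotion_id : IsRigidMotion id :=
  ⟨0, 0, fun p => by simp⟩

lemma DReach.trans {k l : ℕ} {a b c : Set Plane × Set Plane} (h₁ : DReach k a b)
    (h₂ : DReach l b c) : DReach (k + l) a c := by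
  induction h₁ with
  | refl => simpa using h₂
  | step s _ ih =>
    rw [Nat.add_right_comm]
    exact DReach.step s (ih h₂)

lemma DStep.reach {a b : Set Plane × Set Plane} (h : DStep a b) : DReach 1 a b :=
  DReach.step h (DReach.refl b)

lemma DReach.swap {k : ℕ} {a b : Set Plane × Set Plane} (h : DReach k a b) :
    DReach k a.swap b.swap := by
  induction h with
  | refl => exact DReach.refl _
  | step s _ ih =>
    refine DReach.step ?_ ih
    cases s with
    | snip1 g hg => exact DStep.snip2 g hg _ _
    | snip2 g hg => exact DStep.snip1 g hg _ _
    | reset1 => exact DStep.reset2 _ _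
    | reset2 => exact DStep.reset1 _ _

/-- Whatever the second tool is, the first tool can be turned from `T` into `T'` with at most `K`
operations. -/
def Turns (K : ℕ) (T T' : Set Plane) : Prop :=
  ∀ S, ∃ k ≤ K, ∃ S', DReach k (T, S) (T', S')

lemma Turns.refl (T : Set Plane) : Turns 0 T T :=
  fun S => ⟨0, le_rfl, S, DReach.refl _⟩

lemma Turns.trans {K L : ℕ} {T T' T'' : Set Plane} (h₁ : Turns K T T') (h₂ : Turns L T' T'') :
    Turns (K + L) T T'' := by
  intro S
  obtain ⟨k, hk, S', h⟩ := h₁ S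
  obtain ⟨l, hl, S'', h'⟩ := h₂ S'
  exact ⟨k + l, by omega, S'', h.trans h'⟩

lemma Turns.mono {K L : ℕ} {T T' : Set Plane} (h : Turns K T T') (hKL : K ≤ L) :
    Turns L T T' := by
  intro S
  obtain ⟨k, hk, S', h⟩ := h S
  exact ⟨k, hk.trans hKL, S', h⟩

/-- Removing finitely many pieces one after the other, as long as an invariant which allows the
removal of each single piece is preserved. -/
lemma Turns.remove_finset {ι : Type*} (A : Finset ι) (E : ι → Set Plane) (c : ℕ)
    (Inv : Set Plane → Prop)
    (h : ∀ i ∈ A, ∀ T, Inv T → Turns c T (T \ closure (E i)) ∧ Inv (T \ closure (E i)))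
    (T : Set Plane) (hT : Inv T) :
    Turns (c * A.card) T (T \ ⋃ i ∈ A, closure (E i)) ∧ Inv (T \ ⋃ i ∈ A, closure (E i)) := by
  classical
  induction A using Finset.induction_on with
  | empty => simpa using ⟨Turns.refl T, hT⟩
  | insert a s ha ih =>
    obtain ⟨h₁, h₂⟩ := ih fun i hi => h i (Finset.mem_insert_of_mem hi)
    obtain ⟨h₃, h₄⟩ := h a (Finset.mem_insert_self a s) _ h₂
    have : (T \ ⋃ i ∈ insert a s, closure (E i))
        = (T \ ⋃ i ∈ s, closure (E i)) \ closure (E a) := by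
      rw [Finset.set_biUnion_insert, sdiff_sdiff, union_comm]
    rw [this, Finset.card_insert_of_notMem ha, mul_add, mul_one]
    exact ⟨h₁.trans h₃, h₄⟩

/-- Cutting the second tool successively with copies of the first tool. -/
lemma dReach_cuts (T : Set Plane) (ks : List (Plane → Plane)) (hks : ∀ k ∈ ks, IsRigidMotion k)
    (S : Set Plane) :
    DReach ks.length (T, S) (T, S \ {z | ∃ k ∈ ks, z ∈ closure (k '' T)}) := by
  induction ks generalizing S with
  | nil => simpa using DReach.refl (T, S)
  | cons k ks ih =>
    have h := ih (fun k hk => hks k (List.mem_cons_of_mem _ hk)) (S \ closure (k '' T))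
    have : (S \ {z | ∃ k' ∈ k :: ks, z ∈ closure (k' '' T)})
        = (S \ closure (k '' T)) \ {z | ∃ k ∈ ks, z ∈ closure (k '' T)} := by
      ext z
      simp only [List.mem_cons, exists_eq_or_imp, mem_sdiff, mem_ofPred_eq, not_or, and_assoc]
    rw [this]
    exact DReach.step (DStep.snip2 k (hks k List.mem_cons_self) _ _) h

/-- The affine function vanishing at `h.1` with gradient `h.2`. -/
def affineAt (h : Plane × Plane) (z : Plane) : ℝ :=
  h.2.1 * (z.1 - h.1.1) + h.2.2 * (z.2 - h.1.2)

/-- `z` lies in the open sup-norm ball of radius `ρ` around `p`. -/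
def Near (p : Plane) (ρ : ℝ) (z : Plane) : Prop := |z.1 - p.1| < ρ ∧ |z.2 - p.2| < ρ

/-- A set that, after a rigid motion, contains a box of size comparable with `r` sitting on the
horizontal axis, and lies above this axis within a much larger distance. Its copies can be used
to cut along straight lines within distance comparable with `r`. -/
def IsCutter (T : Set Plane) (r : ℝ) : Prop :=
  ∃ k₀, IsRigidMotion k₀ ∧ (Ioo (-r) r ×ˢ Ioo 0 (r / 2) ⊆ k₀ '' T) ∧
    ∀ w ∈ k₀ '' T, Near 0 (100 * r) w → 0 < w.2

lemma exists_polar (d : Plane) (hd : d ≠ 0) :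
    ∃ ρ > 0, ∃ θ : ℝ, d.1 = -(ρ * Real.sin θ) ∧ d.2 = ρ * Real.cos θ := by
  have hw : (⟨d.2, -d.1⟩ : ℂ) ≠ 0 := by
    intro h
    rw [Complex.ext_iff] at h
    simp only [Complex.zero_re, Complex.zero_im, neg_eq_zero] at h
    exact hd (Prod.ext h.2 h.1)
  refine ⟨‖(⟨d.2, -d.1⟩ : ℂ)‖, norm_pos_iff.2 hw, Complex.arg ⟨d.2, -d.1⟩, ?_, ?_⟩
  · rw [Complex.norm_mul_sin_arg]
    simp
  · rw [Complex.norm_mul_cos_arg]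

lemma IsCutter.exists_cuts {T : Set Plane} {r : ℝ} (hr : 0 < r) (hT : IsCutter T r) (p : Plane)
    (h : Plane × Plane) (hd : h.2 ≠ 0) (ho : |h.1.1 - p.1| ≤ 4 * r ∧ |h.1.2 - p.2| ≤ 4 * r) :
    ∃ ks : List (Plane → Plane), ks.length = 561 ∧ (∀ k ∈ ks, IsRigidMotion k) ∧
      ∀ z, Near p (4 * r) z → (affineAt h z < 0 ↔ ¬ ∃ k ∈ ks, z ∈ closure (k '' T)) := by
  obtain ⟨k₀, hk₀, hbox, hup⟩ := hT
  obtain ⟨o, d⟩ := h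
  obtain ⟨ρ, hρ, θ, hd1, hd2⟩ := exists_polar d hd
  simp only at ho hd1 hd2
  set e : ℕ × ℕ → (Plane ≃ₜ Plane) := fun ij =>
    rigidHomeo θ (o.1 + Real.cos θ * (2 * r * (ij.1 - 8)) - Real.sin θ * (r / 2 * ij.2),
      o.2 + Real.sin θ * (2 * r * (ij.1 - 8)) + Real.cos θ * (r / 2 * ij.2)) with he
  have hcs := Real.sin_sq_add_cos_sq θ
  have hes : ∀ ij z, (e ij).symm z = (Real.cos θ * (z.1 - o.1) + Real.sin θ * (z.2 - o.2)
      - 2 * r * (ij.1 - 8), -Real.sin θ * (z.1 - o.1) + Real.cos θ * (z.2 - o.2)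
      - r / 2 * ij.2) := by
    intro ij z
    rw [Homeomorph.symm_apply_eq]
    change z = (_, _)
    ext
    · simp only
      linear_combination -(z.1 - o.1) * hcs
    · simp only
      linear_combination -(z.2 - o.2) * hcs
  have hclos : ∀ ij, closure ((e ij ∘ k₀) '' T) = e ij '' closure (k₀ '' T) := by
    intro ij
    rw [image_comp, Homeomorph.image_closure]
  refine ⟨(List.range 17 ×ˢ List.range 33).map fun ij => e ij ∘ k₀, ?_, ?_, ?_⟩
  · rw [List.length_map, List.length_product, List.length_range, List.length_range]
  · intro k hk
    obtain ⟨ij, -, rfl⟩ := List.mem_map.1 hk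
    exact (isRigidMotion_rigidHomeo _ _).comp hk₀
  · intro z hz
    have hs := Real.abs_sin_le_one θ
    have hc := Real.abs_cos_le_one θ
    have hz1 : |z.1 - o.1| < 8 * r := by
      have := abs_sub_le z.1 p.1 o.1
      rw [abs_sub_comm p.1] at this
      linarith [hz.1]
    have hz2 : |z.2 - o.2| < 8 * r := by
      have := abs_sub_le z.2 p.2 o.2
      rw [abs_sub_comm p.2] at this
      linarith [hz.2]
    set u1 := Real.cos θ * (z.1 - o.1) + Real.sin θ * (z.2 - o.2) with hu1
    set u2 := -Real.sin θ * (z.1 - o.1) + Real.cos θ * (z.2 - o.2) with hu2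
    have key : ∀ a b : ℝ, |a| ≤ 1 → |b| < 8 * r → |a * b| < 8 * r := by
      intro a b ha hb
      rw [abs_mul]
      nlinarith [abs_nonneg a, abs_nonneg b]
    have hu1' : |u1| < 16 * r := by
      have := abs_add_le (Real.cos θ * (z.1 - o.1)) (Real.sin θ * (z.2 - o.2))
      linarith [key _ _ hc hz1, key _ _ hs hz2]
    have hu2' : |u2| < 16 * r := by
      have := abs_add_le (-Real.sin θ * (z.1 - o.1)) (Real.cos θ * (z.2 - o.2))
      linarith [key _ _ (by rwa [abs_neg] : |-Real.sin θ| ≤ 1) hz1, key _ _ hc hz2]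
    have hA : affineAt (o, d) z = ρ * u2 := by
      simp only [affineAt, hd1, hd2, hu2]
      ring
    rw [abs_lt] at hu1' hu2'
    have hsgn : affineAt (o, d) z < 0 ↔ u2 < 0 := by
      rw [hA]
      exact ⟨fun h => by by_contra! h'; nlinarith [mul_nonneg hρ.le h'],
        fun h => mul_neg_of_pos_of_neg hρ h⟩
    rw [hsgn]
    constructor
    · rintro hu ⟨k, hk, hzk⟩
      obtain ⟨⟨i, j⟩, hij, rfl⟩ := List.mem_map.1 hk
      replace hij := List.pair_mem_product.1 hij
      rw [List.mem_range, List.mem_range] at hij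
      have hi : (i : ℝ) < 17 := by exact_mod_cast hij.1
      have hj : (j : ℝ) < 33 := by exact_mod_cast hij.2
      have hi0 : (0 : ℝ) ≤ i := i.cast_nonneg
      have hj0 : (0 : ℝ) ≤ j := j.cast_nonneg
      rw [hclos, ← (e (i, j)).preimage_symm, mem_preimage, hes] at hzk
      rw [mem_closure_iff] at hzk
      have hopen : IsOpen {w : Plane | Near 0 (100 * r) w ∧ w.2 < 0} := by
        have h1 : IsOpen {w : Plane | |w.1 - (0 : Plane).1| < 100 * r} :=
          isOpen_lt (by fun_prop) (by fun_prop)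
        have h2 : IsOpen {w : Plane | |w.2 - (0 : Plane).2| < 100 * r} :=
          isOpen_lt (by fun_prop) (by fun_prop)
        have h3 : IsOpen {w : Plane | w.2 < 0} := isOpen_lt (by fun_prop) (by fun_prop)
        exact (h1.inter h2).inter h3
      obtain ⟨w, hw, hwT⟩ := hzk _ hopen (by
        simp only [Near, mem_ofPred_eq, Prod.fst_zero, Prod.snd_zero, sub_zero, abs_lt]
        refine ⟨⟨⟨?_, ?_⟩, ?_, ?_⟩, ?_⟩ <;> nlinarith)
      exact absurd (hup w hwT hw.1) (not_lt.2 hw.2.le)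
    · intro hno
      by_contra! hu
      apply hno
      have h1 : 0 ≤ (u1 + 17 * r) / (2 * r) := by
        apply div_nonneg <;> linarith
      have h2 : 0 ≤ u2 / (r / 2) := by positivity
      obtain ⟨i, hi⟩ : ∃ i, i = ⌊(u1 + 17 * r) / (2 * r)⌋₊ := ⟨_, rfl⟩
      obtain ⟨j, hj⟩ : ∃ j, j = ⌊u2 / (r / 2)⌋₊ := ⟨_, rfl⟩
      have i1 := Nat.floor_le h1
      have i2 := Nat.lt_floor_add_one ((u1 + 17 * r) / (2 * r))
      have j1 := Nat.floor_le h2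
      have j2 := Nat.lt_floor_add_one (u2 / (r / 2))
      rw [← hi, le_div_iff₀ (by positivity)] at i1
      rw [← hi, div_lt_iff₀ (by positivity)] at i2
      rw [← hj, le_div_iff₀ (by positivity)] at j1
      rw [← hj, div_lt_iff₀ (by positivity)] at j2
      have hi17 : i < 17 := by
        have : (i : ℝ) < 17 := by
          by_contra! h
          linarith [mul_le_mul_of_nonneg_right h (by positivity : 0 ≤ 2 * r)]
        exact_mod_cast this
      have hj33 : j < 33 := by
        have : (j : ℝ) < 33 := by
          by_contra! h
          linarith [mul_le_mul_of_nonneg_right h (by positivity : 0 ≤ r / 2)]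
        exact_mod_cast this
      refine ⟨e (i, j) ∘ k₀, List.mem_map.2 ⟨(i, j), ?_, rfl⟩, ?_⟩
      · exact List.pair_mem_product.2 ⟨List.mem_range.2 hi17, List.mem_range.2 hj33⟩
      · rw [hclos, ← (e (i, j)).preimage_symm, mem_preimage, hes]
        apply closure_mono hbox
        rw [closure_prod_eq, closure_Ioo (by linarith), closure_Ioo (by linarith)]
        refine ⟨⟨?_, ?_⟩, ?_, ?_⟩ <;> simp only <;> linarith

/-- A part of the visible piece `V = g '' UnitSq ∩ UnitSq` of the second tool that is bounded by
straight lines can be removed from the first tool. -/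
lemma IsCutter.turns_remove {T : Set Plane} (hTU : T ⊆ UnitSq) {r : ℝ} (hr : 0 < r)
    (hT : IsCutter T r) (p : Plane) {g : Plane → Plane} (hg : IsRigidMotion g)
    (hV : ∀ z ∈ g '' UnitSq ∩ UnitSq, Near p (4 * r) z) (hs : List (Plane × Plane))
    (hd : ∀ h ∈ hs, h.2 ≠ 0)
    (ho : ∀ h ∈ hs, |h.1.1 - p.1| ≤ 4 * r ∧ |h.1.2 - p.2| ≤ 4 * r) :
    Turns (561 * hs.length + 2) T
      (T \ closure (g '' UnitSq ∩ UnitSq ∩ {z | ∀ h ∈ hs, affineAt h z < 0})) := by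
  have cuts : ∃ ks : List (Plane → Plane), ks.length = 561 * hs.length ∧
      (∀ k ∈ ks, IsRigidMotion k) ∧ ∀ z, Near p (4 * r) z →
        ((∀ h ∈ hs, affineAt h z < 0) ↔ ¬ ∃ k ∈ ks, z ∈ closure (k '' T)) := by
    clear hV
    induction hs with
    | nil => exact ⟨[], by simp, by simp, by simp⟩
    | cons h hs ih =>
      obtain ⟨ks, h1, h2, h3⟩ := ih (fun h hh => hd h (List.mem_cons_of_mem _ hh))
        (fun h hh => ho h (List.mem_cons_of_mem _ hh))
      obtain ⟨ks', h1', h2', h3'⟩ := hT.exists_cuts hr p h (hd h List.mem_cons_self)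
        (ho h List.mem_cons_self)
      refine ⟨ks' ++ ks, ?_, ?_, ?_⟩
      · rw [List.length_append, h1, h1', List.length_cons]
        ring
      · intro k hk
        rcases List.mem_append.1 hk with hk | hk
        exacts [h2' k hk, h2 k hk]
      · intro z hz
        simp only [List.mem_cons, forall_eq_or_imp, h3' z hz, h3 z hz, List.mem_append, or_and_right,
          exists_or, not_or]
  obtain ⟨ks, hlen, hrig, hks⟩ := cuts
  obtain ⟨θ, v, rfl⟩ := hg.exists_rigidHomeo
  set e := rigidHomeo θ v
  have hcut := dReach_cuts T (ks.map fun k => e.symm ∘ k) (by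
    intro k hk
    obtain ⟨k, hk', rfl⟩ := List.mem_map.1 hk
    exact (isRigidMotion_rigidHomeo_symm _ _).comp (hrig k hk')) UnitSq
  set S := UnitSq \ {z | ∃ k ∈ ks.map fun k => e.symm ∘ k, z ∈ closure (k '' T)} with hS
  have hSe : e '' S = e '' UnitSq \ {z | ∃ k ∈ ks, z ∈ closure (k '' T)} := by
    rw [hS, image_sdiff e.injective]
    congr 1
    ext z
    rw [← e.preimage_symm]
    simp only [List.mem_map, mem_preimage, mem_ofPred_eq, exists_exists_and_eq_and]
    simp only [image_comp, ← e.symm.image_closure, e.symm.injective.mem_set_image]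
  have hvis : e '' S ∩ UnitSq = e '' UnitSq ∩ UnitSq ∩ {z | ∀ h ∈ hs, affineAt h z < 0} := by
    rw [hSe]
    ext z
    simp only [mem_inter_iff, mem_sdiff, mem_ofPred_eq]
    constructor
    · rintro ⟨⟨h1, h2⟩, h3⟩
      exact ⟨⟨h1, h3⟩, (hks z (hV z ⟨h1, h3⟩)).2 h2⟩
    · rintro ⟨⟨h1, h3⟩, h2⟩
      exact ⟨⟨h1, (hks z (hV z ⟨h1, h3⟩)).1 h2⟩, h3⟩
  have hfin : T \ closure (e '' S)
      = T \ closure (e '' UnitSq ∩ UnitSq ∩ {z | ∀ h ∈ hs, affineAt h z < 0}) := by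
    rw [← hvis]
    ext z
    simp only [mem_sdiff, and_congr_right_iff]
    intro hz
    rw [not_iff_not]
    constructor
    · intro h
      rw [inter_comm]
      exact isOpen_unitSq.inter_closure ⟨hTU hz, h⟩
    · exact fun h => closure_mono inter_subset_left h
  intro S₀
  refine ⟨1 + ((ks.map fun k => e.symm ∘ k).length + 1), ?_, S, ?_⟩
  · rw [List.length_map, hlen]
    omega
  · rw [← hfin]
    exact (DStep.reset2 T S₀).reach.trans (hcut.trans (DStep.snip1 e hg T S).reach)

/-- The cross product of two vectors of the plane. -/
def cross (d e : Plane) : ℝ := d.1 * e.2 - d.2 * e.1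

/-- A parametrization of the zero set of `affineAt h`. -/
def onLine (h : Plane × Plane) (t : ℝ) : Plane := (h.1.1 - t * h.2.2, h.1.2 + t * h.2.1)

/-- The parameter of the intersection point of the line of `h` with the line of `k`. -/
noncomputable def crossing (h k : Plane × Plane) : ℝ := -affineAt k h.1 / cross h.2 k.2

lemma affineAt_onLine (h k : Plane × Plane) (t : ℝ) :
    affineAt k (onLine h t) = affineAt k h.1 + t * cross h.2 k.2 := by
  simp only [affineAt, onLine, cross]
  ring

lemma affineAt_onLine_of_cross_ne_zero {h k : Plane × Plane} (hc : cross h.2 k.2 ≠ 0) (t : ℝ) :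
    affineAt k (onLine h t) = cross h.2 k.2 * (t - crossing h k) := by
  rw [affineAt_onLine, crossing]
  field_simp
  ring

lemma affineAt_onLine_of_cross_eq_zero {h k : Plane × Plane} (hc : cross h.2 k.2 = 0) (t t' : ℝ) :
    affineAt k (onLine h t) = affineAt k (onLine h t') := by
  simp [affineAt_onLine, hc]

lemma exists_onLine {h : Plane × Plane} (hd : h.2 ≠ 0) {z : Plane} (hz : affineAt h z = 0) :
    ∃ t, z = onLine h t := by
  have hpos : h.2.1 ^ 2 + h.2.2 ^ 2 ≠ 0 := by
    intro h0
    refine hd (Prod.ext ?_ ?_) <;> simp only [Prod.fst_zero, Prod.snd_zero] <;> nlinarith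
  simp only [affineAt] at hz
  refine ⟨(h.2.1 * (z.2 - h.1.2) - h.2.2 * (z.1 - h.1.1)) / (h.2.1 ^ 2 + h.2.2 ^ 2), ?_⟩
  ext
  · simp only [onLine]
    field_simp
    linear_combination h.2.1 * hz
  · simp only [onLine]
    field_simp
    linear_combination h.2.2 * hz

/-- The three half planes bounding the open triangle with vertices `q`, `a`, `b`. -/
def triangle (q a b : Plane) : List (Plane × Plane) :=
  let D := cross (a - q) (b - q)
  [(q, D * (a.2 - q.2), -(D * (a.1 - q.1))), (q, -(D * (b.2 - q.2)), D * (b.1 - q.1)),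
    (a, D * (b.2 - a.2), -(D * (b.1 - a.1)))]

lemma triangle_snd_ne_zero {q a b : Plane} (hD : cross (a - q) (b - q) ≠ 0) :
    ∀ h ∈ triangle q a b, h.2 ≠ 0 := by
  intro h hh h0
  have h1 := congrArg Prod.fst h0
  have h2 := congrArg Prod.snd h0
  apply hD
  simp only [triangle, List.mem_cons, List.not_mem_nil, or_false] at hh
  rcases hh with rfl | rfl | rfl <;>
    simp only [Prod.fst_zero, Prod.snd_zero, neg_eq_zero, mul_eq_zero, hD, false_or] at h1 h2 <;>
    simp only [cross, Prod.fst_sub, Prod.snd_sub]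
  · simp [h1, h2]
  · simp [h1, h2]
  · linear_combination (a.1 - q.1) * h1 - (a.2 - q.2) * h2

lemma fst_of_mem_triangle {q a b : Plane} : ∀ h ∈ triangle q a b, h.1 = q ∨ h.1 = a := by
  intro h hh
  simp only [triangle, List.mem_cons, List.not_mem_nil, or_false] at hh
  rcases hh with rfl | rfl | rfl <;> simp

lemma affineAt_mul_pos_of_triangle {q a b z : Plane} (hD : cross (a - q) (b - q) ≠ 0)
    (hz : ∀ h ∈ triangle q a b, affineAt h z < 0) (k : Plane × Plane) {s : ℝ}
    (hq : 0 < affineAt k q * s) (ha : 0 ≤ affineAt k a * s) (hb : 0 ≤ affineAt k b * s) :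
    0 < affineAt k z * s := by
  have hz1 := hz (q, _, _) (by simp only [triangle, List.mem_cons]; left; rfl)
  have hz2 := hz (q, _, _) (by simp only [triangle, List.mem_cons]; right; left; rfl)
  have hz3 := hz (a, _, _) (by simp only [triangle, List.mem_cons]; right; right; left; rfl)
  have key : cross (a - q) (b - q) ^ 2 * (affineAt k z * s)
      = -affineAt (a, cross (a - q) (b - q) * (b.2 - a.2), -(cross (a - q) (b - q) * (b.1 - a.1))) z
          * (affineAt k q * s)
        + -affineAt (q, -(cross (a - q) (b - q) * (b.2 - q.2)),
          cross (a - q) (b - q) * (b.1 - q.1)) z * (affineAt k a * s)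
        + -affineAt (q, cross (a - q) (b - q) * (a.2 - q.2),
          -(cross (a - q) (b - q) * (a.1 - q.1))) z * (affineAt k b * s) := by
    simp only [affineAt, cross, Prod.fst_sub, Prod.snd_sub]
    ring
  have h2 : 0 < cross (a - q) (b - q) ^ 2 := by positivity
  have : 0 < cross (a - q) (b - q) ^ 2 * (affineAt k z * s) := by
    rw [key]
    have := mul_pos (neg_pos.2 hz3) hq
    have := mul_nonneg (neg_pos.2 hz2).le ha
    have := mul_nonneg (neg_pos.2 hz1).le hb
    linarith
  exact pos_of_mul_pos_right this h2.le

lemma affineAt_neg_of_mem_triangle {q a b z : Plane} (hD : cross (a - q) (b - q) ≠ 0)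
    {l m n : ℝ} (hl : 0 < l) (hm : 0 < m) (hn : 0 < n) (hs : l + m + n = 1)
    (h1 : z.1 = l * q.1 + m * a.1 + n * b.1) (h2 : z.2 = l * q.2 + m * a.2 + n * b.2) :
    ∀ h ∈ triangle q a b, affineAt h z < 0 := by
  have hD2 : 0 < cross (a - q) (b - q) ^ 2 := by positivity
  obtain rfl : l = 1 - m - n := by linarith
  intro h hh
  simp only [triangle, List.mem_cons, List.not_mem_nil, or_false] at hh
  rcases hh with rfl | rfl | rfl
  · have : affineAt (q, cross (a - q) (b - q) * (a.2 - q.2), -(cross (a - q) (b - q) * (a.1 - q.1))) z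
        = -(cross (a - q) (b - q) ^ 2 * n) := by
      simp only [affineAt, cross, Prod.fst_sub, Prod.snd_sub, h1, h2]
      ring
    rw [this]
    exact neg_neg_of_pos (mul_pos hD2 hn)
  · have : affineAt (q, -(cross (a - q) (b - q) * (b.2 - q.2)), cross (a - q) (b - q) * (b.1 - q.1)) z
        = -(cross (a - q) (b - q) ^ 2 * m) := by
      simp only [affineAt, cross, Prod.fst_sub, Prod.snd_sub, h1, h2]
      ring
    rw [this]
    exact neg_neg_of_pos (mul_pos hD2 hm)
  · have : affineAt (a, cross (a - q) (b - q) * (b.2 - a.2), -(cross (a - q) (b - q) * (b.1 - a.1))) z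
        = -(cross (a - q) (b - q) ^ 2 * (1 - m - n)) := by
      simp only [affineAt, cross, Prod.fst_sub, Prod.snd_sub, h1, h2]
      ring
    rw [this]
    exact neg_neg_of_pos (mul_pos hD2 hl)

section Arrangement

variable {ι : Type*} (L : ι → Plane × Plane)

/-- The ray from `q` through `x` leaves the cell of `q` right after `x`, at the point with
parameter `t` of line number `i`, and it does not hit any other line there. -/
def Exits (q x : Plane) (i : ι) (t : ℝ) : Prop :=
  (∃ ρ : ℝ, 0 < ρ ∧ ρ < 1 ∧ x.1 = ρ * q.1 + (1 - ρ) * (onLine (L i) t).1 ∧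
    x.2 = ρ * q.2 + (1 - ρ) * (onLine (L i) t).2) ∧
  ∀ k, 0 ≤ affineAt (L k) (onLine (L i) t) * affineAt (L k) q ∧
    (cross (L i).2 (L k).2 ≠ 0 → affineAt (L k) (onLine (L i) t) ≠ 0)

/-- On line number `i`, the last crossing before `t` is the one with line number `j`. -/
def LastBefore (i : ι) (t : ℝ) (j : ι) : Prop :=
  cross (L i).2 (L j).2 ≠ 0 ∧ crossing (L i) (L j) < t ∧ ∀ k, cross (L i).2 (L k).2 ≠ 0 →
    crossing (L i) (L k) < t → crossing (L i) (L k) ≤ crossing (L i) (L j)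

/-- On line number `i`, the first crossing after `t` is the one with line number `j`. -/
def FirstAfter (i : ι) (t : ℝ) (j : ι) : Prop :=
  cross (L i).2 (L j).2 ≠ 0 ∧ t < crossing (L i) (L j) ∧ ∀ k, cross (L i).2 (L k).2 ≠ 0 →
    t < crossing (L i) (L k) → crossing (L i) (L j) ≤ crossing (L i) (L k)

/-- The sides of the unit square belong to the family of lines. -/
def HasBox : Prop :=
  (∃ j, L j = ((0, 0), (1, 0))) ∧ (∃ j, L j = ((1, 0), (1, 0))) ∧
  (∃ j, L j = ((0, 0), (0, 1))) ∧ ∃ j, L j = ((0, 1), (0, 1))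

variable {L}

lemma exists_exits [Finite ι] (hL : ∀ j, (L j).2 ≠ 0) (hbox : HasBox L) {q x : Plane}
    (hq : q ∈ UnitSq) (hqx : ∀ j, 0 < affineAt (L j) x * affineAt (L j) q)
    (hgen : ∀ i j, cross (L i).2 (L j).2 ≠ 0 →
      affineAt (L i) x * affineAt (L j) q ≠ affineAt (L j) x * affineAt (L i) q) :
    ∃ i t, Exits L q x i t := by
  obtain ⟨⟨j₁, h₁⟩, ⟨j₂, h₂⟩, ⟨j₃, h₃⟩, j₄, h₄⟩ := hbox
  have hq0 : ∀ j, affineAt (L j) q ≠ 0 := fun j h => by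
    have := hqx j
    rw [h, mul_zero] at this
    exact this.false
  have : Nonempty ι := ⟨j₁⟩
  obtain ⟨i, hi⟩ := Finite.exists_min fun j => affineAt (L j) x / affineAt (L j) q
  set ρ := affineAt (L i) x / affineAt (L i) q with hρ
  have hρ0 : 0 < ρ := by
    rw [hρ, ← mul_div_mul_right _ _ (hq0 i)]
    exact div_pos (hqx i) (mul_self_pos.2 (hq0 i))
  have hρ1 : ρ < 1 := by
    obtain ⟨⟨hq1, hq2⟩, hq3, hq4⟩ := hq
    rcases lt_trichotomy x.1 q.1 with h | h | h
    · refine (hi j₁).trans_lt ?_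
      simp only [h₁, affineAt]
      rw [div_lt_one] <;> linarith
    · rcases lt_trichotomy x.2 q.2 with h' | h' | h'
      · refine (hi j₃).trans_lt ?_
        simp only [h₃, affineAt]
        rw [div_lt_one] <;> linarith
      · refine absurd ?_ (hgen j₁ j₃ (by simp [h₁, h₃, cross]))
        rw [Prod.ext h h']
        ring
      · refine (hi j₄).trans_lt ?_
        simp only [h₄, affineAt]
        rw [div_lt_one_of_neg] <;> linarith
    · refine (hi j₂).trans_lt ?_
      simp only [h₂, affineAt]
      rw [div_lt_one_of_neg] <;> linarith
  have hρ' : 1 - ρ ≠ 0 := by linarith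
  set u : Plane := (q.1 + (x.1 - q.1) / (1 - ρ), q.2 + (x.2 - q.2) / (1 - ρ)) with hu
  have hLu : ∀ k, affineAt (L k) u
      = (affineAt (L k) x / affineAt (L k) q - ρ) / (1 - ρ) * affineAt (L k) q := by
    intro k
    have : (affineAt (L k) x / affineAt (L k) q - ρ) / (1 - ρ) * affineAt (L k) q
        = (affineAt (L k) x - ρ * affineAt (L k) q) / (1 - ρ) := by
      have := hq0 k
      field_simp
    rw [this]
    simp only [hu, affineAt]
    field_simp
    ring
  obtain ⟨t, ht⟩ : ∃ t, u = onLine (L i) t :=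
    exists_onLine (hL i) (by rw [hLu, ← hρ, sub_self, zero_div, zero_mul])
  refine ⟨i, t, ⟨ρ, hρ0, hρ1, ?_, ?_⟩, fun k => ⟨?_, ?_⟩⟩
  · rw [← ht, hu]
    field_simp
    ring
  · rw [← ht, hu]
    field_simp
    ring
  · rw [← ht, hLu, mul_assoc]
    exact mul_nonneg (div_nonneg (sub_nonneg.2 (hi k)) (by linarith)) (mul_self_nonneg _)
  · intro hc h0
    rw [← ht, hLu, mul_eq_zero, or_iff_left (hq0 k), div_eq_zero_iff, or_iff_left hρ', hρ,
      sub_eq_zero, div_eq_div_iff (hq0 k) (hq0 i)] at h0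
    exact hgen i k hc h0.symm

lemma Exits.affineAt_mul_pos {q x : Plane} {i : ι} {t : ℝ} (h : Exits L q x i t)
    (hq : ∀ j, affineAt (L j) q ≠ 0) {k : ι} (hk : cross (L i).2 (L k).2 ≠ 0) :
    0 < affineAt (L k) (onLine (L i) t) * affineAt (L k) q :=
  (h.2 k).1.lt_of_ne' (mul_ne_zero ((h.2 k).2 hk) (hq k))

lemma Exits.crossing_ne {q x : Plane} {i : ι} {t : ℝ} (h : Exits L q x i t)
    {k : ι} (hk : cross (L i).2 (L k).2 ≠ 0) : crossing (L i) (L k) ≠ t := by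
  rintro rfl
  refine (h.2 k).2 hk ?_
  rw [affineAt_onLine_of_cross_ne_zero hk, sub_self, mul_zero]

lemma Exits.exists_crossing [Finite ι] (hL : ∀ j, (L j).2 ≠ 0) (hbox : HasBox L) {q x : Plane}
    (hq : q ∈ UnitSq) {i : ι} {t : ℝ} (h : Exits L q x i t) :
    (∃ j, LastBefore L i t j) ∧ ∃ j, FirstAfter L i t j := by
  obtain ⟨⟨j₁, h₁⟩, ⟨j₂, h₂⟩, ⟨j₃, h₃⟩, j₄, h₄⟩ := hbox
  obtain ⟨⟨hq1, hq2⟩, hq3, hq4⟩ := hq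
  have key : (∃ j, cross (L i).2 (L j).2 ≠ 0 ∧ crossing (L i) (L j) < t) ∧
      ∃ j, cross (L i).2 (L j).2 ≠ 0 ∧ t < crossing (L i) (L j) := by
    have opposite : ∀ k k', cross (L i).2 (L k).2 = cross (L i).2 (L k').2 →
        cross (L i).2 (L k).2 ≠ 0 → 0 < affineAt (L k) q → affineAt (L k') q < 0 →
        (∃ j, cross (L i).2 (L j).2 ≠ 0 ∧ crossing (L i) (L j) < t) ∧
          ∃ j, cross (L i).2 (L j).2 ≠ 0 ∧ t < crossing (L i) (L j) := by
      intro k k' hkk' hk hkq hkq'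
      have hk' := hkk' ▸ hk
      have h1 := (h.2 k).1
      have h2 := (h.2 k').1
      rw [affineAt_onLine_of_cross_ne_zero hk] at h1
      rw [affineAt_onLine_of_cross_ne_zero hk', ← hkk'] at h2
      have h1 := nonneg_of_mul_nonneg_left h1 hkq
      have h2 := nonpos_of_mul_nonneg_left h2 hkq'
      rcases lt_or_gt_of_ne hk with hc | hc
      · have := sub_nonpos.1 (nonpos_of_mul_nonneg_right h1 hc)
        have := sub_nonneg.1 (nonneg_of_mul_nonpos_right h2 hc)
        exact ⟨⟨k', hk', lt_of_le_of_ne this (h.crossing_ne hk')⟩,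
          ⟨k, hk, lt_of_le_of_ne ‹_› (h.crossing_ne hk).symm⟩⟩
      · have := sub_nonneg.1 (nonneg_of_mul_nonneg_right h1 hc)
        have := sub_nonpos.1 (nonpos_of_mul_nonpos_right h2 hc)
        exact ⟨⟨k, hk, lt_of_le_of_ne ‹_› (h.crossing_ne hk)⟩,
          ⟨k', hk', lt_of_le_of_ne this (h.crossing_ne hk').symm⟩⟩
    by_cases hd : (L i).2.2 = 0
    · have hd1 : (L i).2.1 ≠ 0 := fun h0 => hL i (Prod.ext h0 hd)
      exact opposite j₃ j₄ (by simp [cross, h₃, h₄]) (by simpa [cross, h₃] using hd1)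
        (by simpa [h₃, affineAt] using hq3) (by simpa [h₄, affineAt] using hq4)
    · exact opposite j₁ j₂ (by simp [cross, h₁, h₂]) (by simpa [cross, h₁] using hd)
        (by simpa [h₁, affineAt] using hq1) (by simpa [h₂, affineAt] using hq2)
  obtain ⟨⟨j, hj, hjt⟩, j', hj', hjt'⟩ := key
  constructor
  · obtain ⟨m, hm, hmax⟩ := Set.exists_max_image
      {k | cross (L i).2 (L k).2 ≠ 0 ∧ crossing (L i) (L k) < t} (fun k => crossing (L i) (L k))
      (Set.toFinite _) ⟨j, hj, hjt⟩
    exact ⟨m, hm.1, hm.2, fun k hk hkt => hmax k ⟨hk, hkt⟩⟩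
  · obtain ⟨m, hm, hmin⟩ := Set.exists_min_image
      {k | cross (L i).2 (L k).2 ≠ 0 ∧ t < crossing (L i) (L k)} (fun k => crossing (L i) (L k))
      (Set.toFinite _) ⟨j', hj', hjt'⟩
    exact ⟨m, hm.1, hm.2, fun k hk hkt => hmin k ⟨hk, hkt⟩⟩

lemma mul_nonneg_of_mul_pos {a b c : ℝ} (h₁ : 0 ≤ a * b) (h₂ : 0 < b * c) : 0 ≤ a * c := by
  have hb : b ≠ 0 := left_ne_zero_of_mul h₂.ne'
  have h := mul_nonneg h₁ h₂.le
  rw [show a * b * (b * c) = a * c * (b * b) by ring] at h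
  exact nonneg_of_mul_nonneg_left h (mul_self_pos.2 hb)

lemma mul_pos_of_mul_pos {a b c : ℝ} (h₁ : 0 < a * b) (h₂ : 0 < b * c) : 0 < a * c :=
  (mul_nonneg_of_mul_pos h₁.le h₂).lt_of_ne'
    (mul_ne_zero (left_ne_zero_of_mul h₁.ne') (right_ne_zero_of_mul h₂.ne'))

lemma LastBefore.affineAt_mul_nonneg {q x : Plane} {i j : ι} {t : ℝ} (hj : LastBefore L i t j)
    (h : Exits L q x i t) (k : ι) :
    0 ≤ affineAt (L k) (onLine (L i) (crossing (L i) (L j))) * affineAt (L k) q := by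
  have hk := (h.2 k).1
  by_cases hc : cross (L i).2 (L k).2 = 0
  · rwa [affineAt_onLine_of_cross_eq_zero hc _ t]
  · rw [affineAt_onLine_of_cross_ne_zero hc] at hk ⊢
    rcases lt_or_gt_of_ne (h.crossing_ne hc) with h' | h'
    · have h1 := hj.2.2 k hc h'
      have h2 : 0 ≤ cross (L i).2 (L k).2 * affineAt (L k) q :=
        nonneg_of_mul_nonneg_left (by linarith) (sub_pos.2 h')
      linarith [mul_nonneg h2 (sub_nonneg.2 h1)]
    · have h1 := hj.2.1.trans h'
      have h2 : cross (L i).2 (L k).2 * affineAt (L k) q ≤ 0 :=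
        nonpos_of_mul_nonneg_left (by linarith) (sub_neg.2 h')
      linarith [mul_nonneg_of_nonpos_of_nonpos h2 (sub_neg.2 h1).le]

lemma FirstAfter.affineAt_mul_nonneg {q x : Plane} {i j : ι} {t : ℝ} (hj : FirstAfter L i t j)
    (h : Exits L q x i t) (k : ι) :
    0 ≤ affineAt (L k) (onLine (L i) (crossing (L i) (L j))) * affineAt (L k) q := by
  have hk := (h.2 k).1
  by_cases hc : cross (L i).2 (L k).2 = 0
  · rwa [affineAt_onLine_of_cross_eq_zero hc _ t]
  · rw [affineAt_onLine_of_cross_ne_zero hc] at hk ⊢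
    rcases lt_or_gt_of_ne (h.crossing_ne hc) with h' | h'
    · have h1 := h'.trans hj.2.1
      have h2 : 0 ≤ cross (L i).2 (L k).2 * affineAt (L k) q :=
        nonneg_of_mul_nonneg_left (by linarith) (sub_pos.2 h')
      linarith [mul_nonneg h2 (sub_pos.2 h1).le]
    · have h1 := hj.2.2 k hc h'
      have h2 : cross (L i).2 (L k).2 * affineAt (L k) q ≤ 0 :=
        nonpos_of_mul_nonneg_left (by linarith) (sub_neg.2 h')
      linarith [mul_nonneg_of_nonpos_of_nonpos h2 (sub_nonpos.2 h1)]

lemma LastBefore.cross_ne_zero {q : Plane} {i j m : ι} {t : ℝ} (hj : LastBefore L i t j)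
    (hm : FirstAfter L i t m) (hq : affineAt (L i) q ≠ 0) :
    cross (onLine (L i) (crossing (L i) (L j)) - q)
      (onLine (L i) (crossing (L i) (L m)) - q) ≠ 0 := by
  have : cross (onLine (L i) (crossing (L i) (L j)) - q)
      (onLine (L i) (crossing (L i) (L m)) - q)
      = -(crossing (L i) (L m) - crossing (L i) (L j)) * affineAt (L i) q := by
    simp only [cross, onLine, affineAt, Prod.fst_sub, Prod.snd_sub]
    ring
  rw [this]
  exact mul_ne_zero (neg_ne_zero.2 (sub_ne_zero.2 (hj.2.1.trans hm.2.1).ne')) hq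

lemma Exits.affineAt_neg {q x : Plane} {i j m : ι} {t : ℝ} (h : Exits L q x i t)
    (hj : LastBefore L i t j) (hm : FirstAfter L i t m) (hq : affineAt (L i) q ≠ 0) :
    ∀ h ∈ triangle q (onLine (L i) (crossing (L i) (L j))) (onLine (L i) (crossing (L i) (L m))),
      affineAt h x < 0 := by
  obtain ⟨⟨ρ, hρ0, hρ1, h1, h2⟩, -⟩ := h
  have hD := hj.cross_ne_zero hm hq
  obtain ⟨-, hjt, -⟩ := hj
  obtain ⟨-, hmt, -⟩ := hm
  set c := crossing (L i) (L j)
  set c' := crossing (L i) (L m)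
  have hcc : 0 < c' - c := by linarith
  refine affineAt_neg_of_mem_triangle hD (l := ρ) (m := (1 - ρ) * ((c' - t) / (c' - c)))
    (n := (1 - ρ) * ((t - c) / (c' - c))) hρ0 ?_ ?_ ?_ ?_ ?_
  · exact mul_pos (by linarith) (div_pos (by linarith) hcc)
  · exact mul_pos (by linarith) (div_pos (by linarith) hcc)
  · field_simp
    ring
  · rw [h1]
    simp only [onLine]
    field_simp
    ring
  · rw [h2]
    simp only [onLine]
    field_simp
    ring

lemma LastBefore.crossing_lt_iff {i j k : ι} {t t' : ℝ} (hj : LastBefore L i t j)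
    (hj' : LastBefore L i t' j) (hk : cross (L i).2 (L k).2 ≠ 0) :
    crossing (L i) (L k) < t ↔ crossing (L i) (L k) < t' :=
  ⟨fun h => (hj.2.2 k hk h).trans_lt hj'.2.1, fun h => (hj'.2.2 k hk h).trans_lt hj.2.1⟩

lemma Exits.firstAfter {q q' x x' : Plane} {i j m : ι} {t t' : ℝ} (h : Exits L q x i t)
    (h' : Exits L q' x' i t') (hj : LastBefore L i t j) (hj' : LastBefore L i t' j)
    (hm : FirstAfter L i t m) : FirstAfter L i t' m := by
  have key : ∀ k, cross (L i).2 (L k).2 ≠ 0 →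
      (t < crossing (L i) (L k) ↔ t' < crossing (L i) (L k)) := by
    intro k hk
    have h1 := hj.crossing_lt_iff hj' hk
    rw [← not_iff_not, not_lt, not_lt, (h.crossing_ne hk).le_iff_lt,
      (h'.crossing_ne hk).le_iff_lt, h1]
  exact ⟨hm.1, (key m hm.1).1 hm.2.1, fun k hk hkt => hm.2.2 k hk ((key k hk).2 hkt)⟩

lemma Exits.same_side {q q' x x' : Plane} {i j : ι} {t t' : ℝ} (hL : (L i).2 ≠ 0)
    (h : Exits L q x i t) (h' : Exits L q' x' i t') (hj : LastBefore L i t j)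
    (hj' : LastBefore L i t' j) (hq : ∀ k, affineAt (L k) q ≠ 0)
    (hq' : ∀ k, affineAt (L k) q' ≠ 0) (hi : 0 < affineAt (L i) q * affineAt (L i) q') (k : ι) :
    0 < affineAt (L k) q * affineAt (L k) q' := by
  by_cases hc : cross (L i).2 (L k).2 = 0
  · by_cases h0 : affineAt (L k) (onLine (L i) t) = 0
    · refine lt_of_le_of_ne ?_ (mul_ne_zero (hq k) (hq' k)).symm
      have hpos : 0 < ((L i).2.1 ^ 2 + (L i).2.2 ^ 2) ^ 2 := by
        rw [sq_pos_iff]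
        intro h0
        refine hL (Prod.ext ?_ ?_) <;> simp only [Prod.fst_zero, Prod.snd_zero] <;> nlinarith
      have hprop : ∀ z, ((L i).2.1 ^ 2 + (L i).2.2 ^ 2) * affineAt (L k) z
          = ((L i).2.1 * (L k).2.1 + (L i).2.2 * (L k).2.2) * affineAt (L i) z := by
        intro z
        rw [affineAt_onLine, hc, mul_zero, add_zero] at h0
        simp only [affineAt, cross] at h0 hc ⊢
        linear_combination ((L i).2.1 ^ 2 + (L i).2.2 ^ 2) * h0
          + ((L i).2.1 * (z.2 - (L i).1.2) - (L i).2.2 * (z.1 - (L i).1.1)) * hc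
      have : ((L i).2.1 ^ 2 + (L i).2.2 ^ 2) ^ 2 * (affineAt (L k) q * affineAt (L k) q')
          = ((L i).2.1 * (L k).2.1 + (L i).2.2 * (L k).2.2) ^ 2
            * (affineAt (L i) q * affineAt (L i) q') := by
        linear_combination ((L i).2.1 ^ 2 + (L i).2.2 ^ 2) * affineAt (L k) q' * hprop q
          + ((L i).2.1 * (L k).2.1 + (L i).2.2 * (L k).2.2) * affineAt (L i) q * hprop q'
      refine nonneg_of_mul_nonneg_right ?_ hpos
      rw [this]
      positivity
    · have h1 := (h.2 k).1.lt_of_ne' (mul_ne_zero h0 (hq k))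
      have h2 := (h'.2 k).1
      rw [affineAt_onLine_of_cross_eq_zero hc t' t] at h2
      have h2 := h2.lt_of_ne' (mul_ne_zero h0 (hq' k))
      rw [mul_comm] at h1
      exact mul_pos_of_mul_pos h1 h2
  · have h1 := h.affineAt_mul_pos hq hc
    have h2 := h'.affineAt_mul_pos hq' hc
    have h3 : 0 < affineAt (L k) (onLine (L i) t) * affineAt (L k) (onLine (L i) t') := by
      rw [affineAt_onLine_of_cross_ne_zero hc, affineAt_onLine_of_cross_ne_zero hc]
      have h4 : 0 < (t - crossing (L i) (L k)) * (t' - crossing (L i) (L k)) := by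
        have := hj.crossing_lt_iff hj' hc
        rcases lt_or_gt_of_ne (h.crossing_ne hc) with h5 | h5
        · exact mul_pos (sub_pos.2 h5) (sub_pos.2 (this.1 h5))
        · refine mul_pos_of_neg_of_neg (sub_neg.2 h5) (sub_neg.2 ?_)
          exact lt_of_le_of_ne (not_lt.1 fun h6 => h5.asymm (this.2 h6)) (h'.crossing_ne hc).symm
      have h5 : 0 < cross (L i).2 (L k).2 ^ 2 := by positivity
      linarith [mul_pos h5 h4]
    rw [mul_comm] at h1
    exact mul_pos_of_mul_pos (mul_pos_of_mul_pos h1 h3) h2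

lemma dense_affine_ne_zero {a b : ℝ} (hab : a ≠ 0 ∨ b ≠ 0) (c : ℝ) :
    Dense {z : Plane | a * z.1 + b * z.2 + c ≠ 0} := by
  rw [dense_iff_inter_open]
  rintro U hU ⟨z, hz⟩
  by_cases h0 : a * z.1 + b * z.2 + c = 0
  · have hcont : Continuous fun t : ℝ => ((z.1 + t * a, z.2 + t * b) : Plane) := by fun_prop
    have hmem : ∀ᶠ t in nhds (0 : ℝ), ((z.1 + t * a, z.2 + t * b) : Plane) ∈ U :=
      hcont.continuousAt.eventually_mem (hU.mem_nhds (by simpa using hz))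
    obtain ⟨t, ht, ht0⟩ := ((hmem.filter_mono nhdsWithin_le_nhds).and
      (self_mem_nhdsWithin : ∀ᶠ t in nhdsWithin (0 : ℝ) {0}ᶜ, t ∈ ({0}ᶜ : Set ℝ))).exists
    refine ⟨_, ht, ?_⟩
    have hpos : 0 < a ^ 2 + b ^ 2 := by
      rcases hab with h | h <;> positivity
    have : a * (z.1 + t * a) + b * (z.2 + t * b) + c = t * (a ^ 2 + b ^ 2) := by
      linear_combination h0
    simp only [mem_ofPred_eq, this]
    exact mul_ne_zero ht0 hpos.ne'
  · exact ⟨z, hz, h0⟩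

lemma isOpen_affine_ne_zero (a b c : ℝ) : IsOpen {z : Plane | a * z.1 + b * z.2 + c ≠ 0} :=
  isOpen_ne_fun (by fun_prop) continuous_const

/-- Outside of finitely many lines, the unit square is covered by a quadratic number of open
triangles none of which is crossed by one of finitely many given lines. -/
theorem exists_arrangement [Fintype ι] (hL : ∀ j, (L j).2 ≠ 0) (hbox : HasBox L) :
    ∃ (A : Finset (ι × ι × Bool)) (hs : ι × ι × Bool → List (Plane × Plane))
      (x : ι × ι × Bool → Plane),
      (∀ l ∈ A, (hs l).length = 3 ∧ x l ∈ UnitSq ∧ (∀ h ∈ hs l, h.2 ≠ 0 ∧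
          ∀ j, 0 ≤ affineAt (L j) h.1 * affineAt (L j) (x l)) ∧
        ∀ z, (∀ h ∈ hs l, affineAt h z < 0) →
          ∀ j, 0 < affineAt (L j) z * affineAt (L j) (x l)) ∧
      ∀ W, IsOpen W → W.Nonempty → W ⊆ UnitSq →
        ∃ l ∈ A, ∃ z ∈ W, ∀ h ∈ hs l, affineAt h z < 0 := by
  classical
  set s : Plane → ι → SignType := fun z k => SignType.sign (affineAt (L k) z) with hs
  have hQ : ∀ σ : ι → SignType, ∃ q, ∀ z ∈ UnitSq, s z = σ → q ∈ UnitSq ∧ s q = σ := by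
    intro σ
    by_cases h : ∃ z ∈ UnitSq, s z = σ
    · obtain ⟨z, hz, hσ⟩ := h
      exact ⟨z, fun _ _ _ => ⟨hz, hσ⟩⟩
    · exact ⟨0, fun z hz hσ => absurd ⟨z, hz, hσ⟩ h⟩
  choose Q hQ using hQ
  set G : Set Plane := {z | (∀ k, affineAt (L k) z ≠ 0) ∧ ∀ σ i j, cross (L i).2 (L j).2 ≠ 0 →
    affineAt (L j) (Q σ) ≠ 0 →
      affineAt (L i) z * affineAt (L j) (Q σ) ≠ affineAt (L j) z * affineAt (L i) (Q σ)} with hG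
  have hGd : Dense G := by
    have hlin : ∀ h : Plane × Plane, ∀ z, affineAt h z
        = h.2.1 * z.1 + h.2.2 * z.2 + -(h.2.1 * h.1.1 + h.2.2 * h.1.2) := by
      intro h z
      simp only [affineAt]
      ring
    have h1 : ∀ k, IsOpen {z | affineAt (L k) z ≠ 0} ∧ Dense {z | affineAt (L k) z ≠ 0} := by
      intro k
      simp only [hlin]
      refine ⟨isOpen_affine_ne_zero _ _ _, dense_affine_ne_zero ?_ _⟩
      by_contra! h
      exact hL k (Prod.ext h.1 h.2)
    have h2 : ∀ p : (ι → SignType) × ι × ι, IsOpen {z | cross (L p.2.1).2 (L p.2.2).2 ≠ 0 →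
        affineAt (L p.2.2) (Q p.1) ≠ 0 → affineAt (L p.2.1) z * affineAt (L p.2.2) (Q p.1)
          ≠ affineAt (L p.2.2) z * affineAt (L p.2.1) (Q p.1)} ∧
        Dense {z | cross (L p.2.1).2 (L p.2.2).2 ≠ 0 →
        affineAt (L p.2.2) (Q p.1) ≠ 0 → affineAt (L p.2.1) z * affineAt (L p.2.2) (Q p.1)
          ≠ affineAt (L p.2.2) z * affineAt (L p.2.1) (Q p.1)} := by
      rintro ⟨σ, i, j⟩
      by_cases hc : cross (L i).2 (L j).2 = 0
      · simp [hc]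
      by_cases hd : affineAt (L j) (Q σ) = 0
      · simp [hd]
      set c := affineAt (L j) (Q σ)
      set c' := affineAt (L i) (Q σ)
      have hset : ∀ z, affineAt (L i) z * c ≠ affineAt (L j) z * c' ↔
          ((L i).2.1 * c - (L j).2.1 * c') * z.1 + ((L i).2.2 * c - (L j).2.2 * c') * z.2
            + (-((L i).2.1 * (L i).1.1 + (L i).2.2 * (L i).1.2) * c
              + ((L j).2.1 * (L j).1.1 + (L j).2.2 * (L j).1.2) * c') ≠ 0 := by
        intro z
        rw [← sub_ne_zero]
        refine iff_of_eq (congrArg (· ≠ 0) ?_)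
        simp only [affineAt]
        ring
      simp only [ne_eq, hc, hd, not_false_eq_true, forall_const]
      simp only [hset]
      refine ⟨isOpen_affine_ne_zero _ _ _, dense_affine_ne_zero ?_ _⟩
      by_contra! h
      obtain ⟨ha, hb⟩ := h
      refine hd ((mul_eq_zero.1 (?_ : cross (L i).2 (L j).2 * c = 0)).resolve_left hc)
      simp only [cross]
      linear_combination (L j).2.2 * ha - (L j).2.1 * hb
    have hG' : G = (⋂ k, {z | affineAt (L k) z ≠ 0}) ∩ ⋂ p : (ι → SignType) × ι × ι,
        {z | cross (L p.2.1).2 (L p.2.2).2 ≠ 0 → affineAt (L p.2.2) (Q p.1) ≠ 0 →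
          affineAt (L p.2.1) z * affineAt (L p.2.2) (Q p.1)
            ≠ affineAt (L p.2.2) z * affineAt (L p.2.1) (Q p.1)} := by
      ext z
      simp only [hG, mem_ofPred_eq, mem_inter_iff, mem_iInter, Prod.forall]
    rw [hG']
    exact (dense_iInter_of_isOpen (fun k => (h1 k).1) fun k => (h1 k).2).inter_of_isOpen_left
      (dense_iInter_of_isOpen (fun p => (h2 p).1) fun p => (h2 p).2)
      (isOpen_iInter_of_finite fun k => (h1 k).1)
  have hsame : ∀ z w, (∀ k, affineAt (L k) z ≠ 0) → s z = s w →
      ∀ k, 0 < affineAt (L k) z * affineAt (L k) w := by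
    intro z w hz hzw k
    have h1 := congrFun hzw k
    simp only [hs] at h1
    rcases lt_or_gt_of_ne (hz k) with h2 | h2
    · rw [sign_neg h2, eq_comm, sign_eq_neg_one_iff] at h1
      exact mul_pos_of_neg_of_neg h2 h1
    · rw [sign_pos h2, eq_comm, sign_eq_one_iff] at h1
      exact mul_pos h2 h1
  have hsame' : ∀ z w, (∀ k, 0 < affineAt (L k) z * affineAt (L k) w) → s z = s w := by
    intro z w h
    funext k
    rcases pos_and_pos_or_neg_and_neg_of_mul_pos (h k) with ⟨h1, h2⟩ | ⟨h1, h2⟩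
    · simp only [hs, sign_pos h1, sign_pos h2]
    · simp only [hs, sign_neg h1, sign_neg h2]
  have hQx : ∀ x ∈ G, x ∈ UnitSq → ∀ k, 0 < affineAt (L k) x * affineAt (L k) (Q (s x)) :=
    fun x hx hxU => hsame _ _ hx.1 (hQ _ x hxU rfl).2.symm
  set R : ι × ι × Bool → Plane → Prop := fun l x => x ∈ G ∧ x ∈ UnitSq ∧
    ∃ t, Exits L (Q (s x)) x l.1 t ∧ LastBefore L l.1 t l.2.1 ∧
      (l.2.2 = true ↔ 0 < affineAt (L l.1) x) with hR
  have hex : ∀ x ∈ G, x ∈ UnitSq → ∃ l, R l x := by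
    intro x hx hxU
    obtain ⟨i, t, ht⟩ := exists_exits hL hbox (hQ _ x hxU rfl).1 (hQx x hx hxU)
      fun i j hc => hx.2 _ i j hc (right_ne_zero_of_mul (hQx x hx hxU j).ne')
    obtain ⟨⟨j, hj⟩, -⟩ := ht.exists_crossing hL hbox (hQ _ x hxU rfl).1
    exact ⟨(i, j, decide (0 < affineAt (L i) x)), hx, hxU, t, ht, hj, by simp⟩
  have hch : ∀ l, ∃ (x : Plane) (t : ℝ) (m : ι), (∃ y, R l y) → R l x ∧
      Exits L (Q (s x)) x l.1 t ∧ LastBefore L l.1 t l.2.1 ∧ FirstAfter L l.1 t m := by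
    intro l
    by_cases h : ∃ y, R l y
    · obtain ⟨x, hx⟩ := h
      obtain ⟨t, ht, hj, -⟩ := hx.2.2
      obtain ⟨-, m, hm⟩ := ht.exists_crossing hL hbox (hQ _ x hx.2.1 rfl).1
      exact ⟨x, t, m, fun _ => ⟨hx, ht, hj, hm⟩⟩
    · obtain ⟨j, -⟩ := hbox.1
      exact ⟨0, 0, j, fun h' => absurd h' h⟩
  choose X τ m hX using hch
  refine ⟨Finset.univ.filter fun l => ∃ y, R l y, fun l => triangle (Q (s (X l)))
    (onLine (L l.1) (crossing (L l.1) (L l.2.1))) (onLine (L l.1) (crossing (L l.1) (L (m l)))),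
    X, ?_, ?_⟩
  · intro l hl
    obtain ⟨⟨hXG, hXU, -⟩, ht, hj, hm⟩ := hX l (Finset.mem_filter.1 hl).2
    have hqX := hQx _ hXG hXU
    have hD := hj.cross_ne_zero hm (right_ne_zero_of_mul (hqX l.1).ne')
    have hA := fun k => mul_nonneg_of_mul_pos (hj.affineAt_mul_nonneg ht k)
      ((mul_comm _ _).trans_gt (hqX k))
    have hB := fun k => mul_nonneg_of_mul_pos (hm.affineAt_mul_nonneg ht k)
      ((mul_comm _ _).trans_gt (hqX k))
    refine ⟨rfl, hXU, fun h hh => ⟨triangle_snd_ne_zero hD h hh, fun k => ?_⟩, fun z hz k => ?_⟩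
    · rcases fst_of_mem_triangle h hh with h1 | h1
      · rw [h1, mul_comm]
        exact (hqX k).le
      · rw [h1]
        exact hA k
    · exact affineAt_mul_pos_of_triangle hD hz _ ((mul_comm _ _).trans_gt (hqX k)) (hA k) (hB k)
  · intro W hW hWne hWU
    obtain ⟨x, hxW, hxG⟩ := dense_iff_inter_open.1 hGd W hW hWne
    have hxU := hWU hxW
    obtain ⟨l, hl⟩ := hex x hxG hxU
    obtain ⟨⟨hXG, hXU, -, -, -, hXb⟩, ht, hj, hm⟩ := hX l ⟨x, hl⟩
    refine ⟨l, Finset.mem_filter.2 ⟨Finset.mem_univ _, x, hl⟩, x, hxW, ?_⟩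
    obtain ⟨-, -, t, ht', hj', hxb⟩ := hl
    have hqX := hQx _ hXG hXU
    have hqx := hQx _ hxG hxU
    have hXx : 0 < affineAt (L l.1) (X l) * affineAt (L l.1) x := by
      have h1 := hXG.1 l.1
      have h2 := hxG.1 l.1
      by_cases hb : l.2.2 = true
      · exact mul_pos (hXb.1 hb) (hxb.1 hb)
      · exact mul_pos_of_neg_of_neg ((not_lt.1 (mt hXb.2 hb)).lt_of_ne h1)
          ((not_lt.1 (mt hxb.2 hb)).lt_of_ne h2)
    have hside := ht.same_side (hL l.1) ht' hj hj' (fun k => right_ne_zero_of_mul (hqX k).ne')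
      (fun k => right_ne_zero_of_mul (hqx k).ne')
      (mul_pos_of_mul_pos ((mul_comm _ _).trans_gt (hqX l.1)) (mul_pos_of_mul_pos hXx (hqx l.1)))
    have hQeq : Q (s (X l)) = Q (s x) := by
      rw [← (hQ _ _ hXU rfl).2, ← (hQ _ _ hxU rfl).2, hsame' _ _ hside]
    simp only [hQeq]
    exact ht'.affineAt_neg hj' (ht.firstAfter ht' hj hj' hm) (right_ne_zero_of_mul (hqx l.1).ne')

end Arrangement

/-- The dyadic scales `1/4, 1/8, 1/16, …`. -/
noncomputable def rad (k : ℕ) : ℝ := (1 / 2) ^ (k + 2)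

lemma rad_pos (k : ℕ) : 0 < rad k := by
  unfold rad
  positivity

lemma rad_succ (k : ℕ) : rad (k + 1) = rad k / 2 := by
  unfold rad
  ring

lemma rad_zero : rad 0 = 1 / 4 := by
  unfold rad
  norm_num

lemma rad_antitone : Antitone rad :=
  antitone_nat_of_succ_le fun k => by linarith [rad_succ k, rad_pos k]

lemma rad_add (j k : ℕ) : rad (j + k) = (1 / 2) ^ k * rad j := by
  unfold rad
  ring

lemma exists_far_point {n : ℕ} (L : Fin n → Plane × Plane) :
    ∃ p : ℝ, 1 / 4 ≤ p ∧ p ≤ 3 / 4 ∧ ∀ i, (∃ x, affineAt (L i) (x, 0) ≠ 0) →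
      ∀ x, |x - p| < rad (n + 1) → affineAt (L i) (x, 0) ≠ 0 := by
  set w : ℝ := 1 / (4 * (n + 1)) with hw
  have hw0 : 0 < w := by positivity
  have hwn : w * (n + 1) = 1 / 4 := by
    rw [hw]
    field_simp
  have hrad : rad (n + 1) ≤ w := by
    have h1 : ((n : ℝ) + 1) ≤ 2 ^ n := by exact_mod_cast Nat.lt_two_pow_self
    rw [hw, rad, div_pow, one_pow]
    apply one_div_le_one_div_of_le (by positivity)
    have : (2 : ℝ) ^ (n + 1 + 2) = 2 ^ n * 8 := by ring
    linarith
  by_contra! hcon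
  have hpt : ∀ m : Fin (n + 1), ∃ i, (∃ x, affineAt (L i) (x, 0) ≠ 0) ∧
      ∃ x, |x - (1 / 4 + (2 * m + 1) * w)| < w ∧ affineAt (L i) (x, 0) = 0 := by
    intro m
    have hm : (m : ℝ) ≤ n := by exact_mod_cast Nat.lt_succ_iff.1 m.2
    have hm0 : (0 : ℝ) ≤ m := by positivity
    obtain ⟨i, hi, x, hx, h0⟩ := hcon (1 / 4 + (2 * m + 1) * w)
      (by nlinarith) (by nlinarith)
    exact ⟨i, hi, x, hx.trans_le hrad, h0⟩
  choose f hf x hx h0 using hpt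
  obtain ⟨m, m', hne, hmm⟩ := Fintype.exists_ne_map_eq_of_card_lt f (by simp)
  wlog hlt : m < m' generalizing m m'
  · exact this m' m hne.symm hmm.symm (lt_of_le_of_ne (not_lt.1 hlt) hne.symm)
  have hlt' : (m : ℝ) + 1 ≤ m' := by exact_mod_cast hlt
  have h1 := abs_lt.1 (hx m)
  have h2 := abs_lt.1 (hx m')
  have hxx : x m < x m' := by nlinarith
  obtain ⟨y, hy⟩ := hf m
  have e1 := h0 m
  have e2 := h0 m'
  rw [← hmm] at e2
  simp only [affineAt] at e1 e2 hy
  have e3 : (L (f m)).2.1 = 0 := by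
    have : (L (f m)).2.1 * (x m' - x m) = 0 := by linarith
    exact (mul_eq_zero.1 this).resolve_right (sub_ne_zero.2 hxx.ne')
  apply hy
  rw [e3] at e1 ⊢
  linarith

/-- Finitely many lines all miss a suitable rectangle that sits just above the bottom side of the
unit square, and whose bottom and top are at heights which differ by a large factor. -/
lemma exists_free_rectangle {n : ℕ} (L : Fin n → Plane × Plane) (hL : ∀ i, (L i).2 ≠ 0) :
    ∃ (p : ℝ) (J : ℕ), 1 / 4 ≤ p ∧ p ≤ 3 / 4 ∧ 10 ≤ J ∧ J ≤ 13 * n + 10 ∧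
      ∀ z : Plane, |z.1 - p| < 256 * rad J → rad J / 4 < z.2 → z.2 < 256 * rad J →
        ∀ i, affineAt (L i) z ≠ 0 := by
  obtain ⟨p, hp1, hp2, hp⟩ := exists_far_point L
  set w := rad (n + 1) with hw
  have hw0 : 0 < w := rad_pos _
  set d : Fin n → ℝ := fun i => |affineAt (L i) (p, 0)| / |(L i).2.2| with hd
  obtain ⟨k, hk⟩ : ∃ k : Fin (n + 1), ∀ i,
      ¬ (rad (n + 1 + 12 * (k + 1)) < d i ∧ d i ≤ rad (n + 1 + 12 * k)) := by
    by_contra! hcon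
    choose f hf1 hf2 using hcon
    obtain ⟨m, m', hne, hmm⟩ := Fintype.exists_ne_map_eq_of_card_lt f (by simp)
    wlog hlt : m < m' generalizing m m'
    · exact this m' m hne.symm hmm.symm (lt_of_le_of_ne (not_lt.1 hlt) hne.symm)
    have hlt' : (m : ℕ) < m' := hlt
    have h1 := rad_antitone (show n + 1 + 12 * ((m : ℕ) + 1) ≤ n + 1 + 12 * m' by omega)
    have h2 := hf1 m
    have h3 := hf2 m'
    rw [← hmm] at h3
    linarith
  have e1 : rad (n + 1 + 12 * (k + 1)) = rad (n + 12 * k + 10) / 8 := by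
    rw [show n + 1 + 12 * ((k : ℕ) + 1) = n + 12 * k + 10 + 3 by ring, rad_add]
    ring
  have e2 : rad (n + 12 * k + 10) = rad (n + 1 + 12 * k) / 512 := by
    rw [show n + 12 * (k : ℕ) + 10 = n + 1 + 12 * k + 9 by ring, rad_add]
    ring
  have e3 : rad (n + 1 + 12 * k) ≤ w := rad_antitone (by omega)
  refine ⟨p, n + 12 * k + 10, hp1, hp2, by omega, by omega, fun z hz1 hz2 hz3 i h0 => ?_⟩
  have hy : 0 < z.2 := by linarith [rad_pos (n + 12 * k + 10)]
  have hsplit : (L i).2.2 * z.2 = -(affineAt (L i) (p, 0) + (L i).2.1 * (z.1 - p)) := by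
    simp only [affineAt] at h0 ⊢
    linarith
  by_cases hi : ∃ x, affineAt (L i) (x, 0) ≠ 0
  · have hg := hp i hi p (by simpa using hw0)
    have hα : |(L i).2.1| * w ≤ |affineAt (L i) (p, 0)| := by
      by_contra! hlt
      have hα0 : (L i).2.1 ≠ 0 := by
        rintro h
        rw [h, abs_zero, zero_mul] at hlt
        exact (abs_nonneg _).not_gt hlt
      refine hp i hi (p - affineAt (L i) (p, 0) / (L i).2.1) ?_ ?_
      · rw [sub_sub_cancel_left, abs_neg, abs_div, div_lt_iff₀ (abs_pos.2 hα0), mul_comm]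
        exact hlt
      · simp only [affineAt]
        field_simp
        ring
    have hα' : |(L i).2.1 * (z.1 - p)| ≤ |affineAt (L i) (p, 0)| / 2 := by
      rw [abs_mul]
      have : |(L i).2.1| * |z.1 - p| ≤ |(L i).2.1| * (w / 2) :=
        mul_le_mul_of_nonneg_left (by linarith) (abs_nonneg _)
      linarith
    have hβ : |(L i).2.2| * z.2 = |affineAt (L i) (p, 0) + (L i).2.1 * (z.1 - p)| := by
      rw [← abs_neg (_ + _), ← hsplit, abs_mul, abs_of_pos hy]
    have hg0 := abs_pos.2 hg
    have hlow : |affineAt (L i) (p, 0)| / 2 ≤ |(L i).2.2| * z.2 := by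
      rw [hβ]
      have := abs_sub_abs_le_abs_add (affineAt (L i) (p, 0)) ((L i).2.1 * (z.1 - p))
      linarith
    have hupp : |(L i).2.2| * z.2 ≤ 3 / 2 * |affineAt (L i) (p, 0)| := by
      rw [hβ]
      have := abs_add_le (affineAt (L i) (p, 0)) ((L i).2.1 * (z.1 - p))
      linarith
    have hβ0 : 0 < |(L i).2.2| := by
      by_contra! h
      nlinarith
    refine hk i ⟨?_, ?_⟩
    · simp only [hd]
      rw [lt_div_iff₀ hβ0]
      nlinarith
    · simp only [hd]
      rw [div_le_iff₀ hβ0]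
      nlinarith
  · push Not at hi
    have h1 := hi p
    have h2 := hi (p + 1)
    have hα0 : (L i).2.1 = 0 := by
      simp only [affineAt] at h1 h2
      linarith
    rw [h1, hα0, zero_mul, add_zero, neg_zero, mul_eq_zero, or_iff_left hy.ne'] at hsplit
    exact hL i (Prod.ext hα0 hsplit)

/-- The intersection of the open half planes given by a list. -/
def piece (hs : List (Plane × Plane)) : Set Plane := {z | ∀ h ∈ hs, affineAt h z < 0}

lemma convex_piece (hs : List (Plane × Plane)) : Convex ℝ (piece hs) := by
  intro z hz w hw s t hs0 ht0 hst h hh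
  have h1 := hz h hh
  have h2 := hw h hh
  have : affineAt h (s • z + t • w) = s * affineAt h z + t * affineAt h w := by
    simp only [affineAt, Prod.fst_add, Prod.snd_add, Prod.smul_fst, Prod.smul_snd, smul_eq_mul]
    linear_combination (h.2.1 * h.1.1 + h.2.2 * h.1.2) * hst
  rw [this]
  rcases hs0.eq_or_lt with rfl | hs0
  · nlinarith
  · nlinarith

/-- The unit square is covered, up to finitely many lines, by a controlled number of triangles
whose interiors avoid some given lines and the boundaries of the boxes of dyadic size that sit
on the bottom side of the square. -/
lemma exists_pieces {n : ℕ} (L : Fin n → Plane × Plane) (hL : ∀ i, (L i).2 ≠ 0) (p : ℝ) (K : ℕ) :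
    ∃ (κ : Type) (A : Finset κ) (hs : κ → List (Plane × Plane)) (x : κ → Plane),
      A.card ≤ 2 * (n + 3 * K + 4) ^ 2 ∧
      (∀ l ∈ A, (hs l).length = 3 ∧ (∀ h ∈ hs l, h.2 ≠ 0) ∧ x l ∈ piece (hs l) ∧
        piece (hs l) ⊆ UnitSq ∧
        (∀ z ∈ piece (hs l), (∀ i, affineAt (L i) z ≠ 0) ∧ ∀ k < K, z.2 ≠ rad k ∧
          (z.2 < rad k ↔ (x l).2 < rad k) ∧ (|z.1 - p| < rad k ↔ |(x l).1 - p| < rad k)) ∧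
        ∀ h ∈ hs l, 0 ≤ h.1.1 ∧ h.1.1 ≤ 1 ∧ 0 ≤ h.1.2 ∧ h.1.2 ≤ 1 ∧
          ∀ k < K, ((x l).2 < rad k → h.1.2 ≤ rad k) ∧
            (|(x l).1 - p| < rad k → |h.1.1 - p| ≤ rad k)) ∧
      ∀ W, IsOpen W → W.Nonempty → W ⊆ UnitSq → ∃ l ∈ A, (W ∩ piece (hs l)).Nonempty := by
  classical
  set M : Fin n ⊕ (Fin 3 × Fin K) ⊕ Fin 4 → Plane × Plane :=
    Sum.elim L (Sum.elim (fun jk => ![((p - rad jk.2, 0), (1, 0)), ((p + rad jk.2, 0), (1, 0)),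
      ((0, rad jk.2), (0, 1))] jk.1)
      ![((0, 0), (1, 0)), ((1, 0), (1, 0)), ((0, 0), (0, 1)), ((0, 1), (0, 1))]) with hM
  have hMd : ∀ j, (M j).2 ≠ 0 := by
    rintro (i | ⟨j, k⟩ | j)
    · exact hL i
    · fin_cases j <;> simp [hM]
    · fin_cases j <;> simp [hM]
  have hbox : HasBox M := ⟨⟨.inr (.inr 0), rfl⟩, ⟨.inr (.inr 1), rfl⟩, ⟨.inr (.inr 2), rfl⟩,
    ⟨.inr (.inr 3), rfl⟩⟩
  obtain ⟨A, hs, y, hA, hdense⟩ := exists_arrangement hMd hbox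
  have hch : ∀ l, ∃ x, (piece (hs l)).Nonempty → x ∈ piece (hs l) := by
    intro l
    by_cases h : (piece (hs l)).Nonempty
    · exact ⟨h.some, fun _ => h.some_mem⟩
    · exact ⟨0, fun h' => absurd h' h⟩
  choose x hx using hch
  refine ⟨_, A.filter fun l => (piece (hs l)).Nonempty, hs, x, ?_, ?_, ?_⟩
  · refine (Finset.card_le_univ _).trans (le_of_eq ?_)
    simp only [Fintype.card_prod, Fintype.card_sum, Fintype.card_fin, Fintype.card_bool]
    ring
  · intro l hl
    obtain ⟨hlA, hne⟩ := Finset.mem_filter.1 hl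
    obtain ⟨hlen, hyU, hbase, hsign⟩ := hA l hlA
    have hxl := hx l hne
    have hxy := hsign _ hxl
    have hz : ∀ z ∈ piece (hs l), ∀ j, 0 < affineAt (M j) z * affineAt (M j) (x l) := by
      intro z hz j
      exact mul_pos_of_mul_pos (hsign z hz j) ((mul_comm _ _).trans_gt (hxy j))
    have hb : ∀ h ∈ hs l, ∀ j, 0 ≤ affineAt (M j) h.1 * affineAt (M j) (x l) := by
      intro h hh j
      exact mul_nonneg_of_mul_pos ((hbase h hh).2 j) ((mul_comm _ _).trans_gt (hxy j))
    have hbox1 : ∀ z, affineAt (M (.inr (.inr 0))) z = z.1 := fun z => by simp [hM, affineAt]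
    have hbox2 : ∀ z, affineAt (M (.inr (.inr 1))) z = z.1 - 1 := fun z => by simp [hM, affineAt]
    have hbox3 : ∀ z, affineAt (M (.inr (.inr 2))) z = z.2 := fun z => by simp [hM, affineAt]
    have hbox4 : ∀ z, affineAt (M (.inr (.inr 3))) z = z.2 - 1 := fun z => by simp [hM, affineAt]
    have hrad1 : ∀ k z, affineAt (M (.inr (.inl (0, k)))) z = z.1 - (p - rad k) :=
      fun k z => by simp [hM, affineAt]
    have hrad2 : ∀ k z, affineAt (M (.inr (.inl (1, k)))) z = z.1 - (p + rad k) :=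
      fun k z => by simp [hM, affineAt]
    have hrad3 : ∀ k z, affineAt (M (.inr (.inl (2, k)))) z = z.2 - rad k :=
      fun k z => by simp [hM, affineAt]
    have hU : ∀ z w, (∀ j, 0 < affineAt (M j) z * affineAt (M j) w) → w ∈ UnitSq → z ∈ UnitSq := by
      rintro z w h ⟨⟨w1, w2⟩, w3, w4⟩
      have h1 := h (.inr (.inr 0))
      have h2 := h (.inr (.inr 1))
      have h3 := h (.inr (.inr 2))
      have h4 := h (.inr (.inr 3))
      rw [hbox1, hbox1] at h1
      rw [hbox2, hbox2] at h2
      rw [hbox3, hbox3] at h3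
      rw [hbox4, hbox4] at h4
      exact ⟨⟨(pos_iff_pos_of_mul_pos h1).2 w1,
        sub_neg.1 ((neg_iff_neg_of_mul_pos h2).2 (sub_neg.2 w2))⟩,
        (pos_iff_pos_of_mul_pos h3).2 w3,
        sub_neg.1 ((neg_iff_neg_of_mul_pos h4).2 (sub_neg.2 w4))⟩
    have hxU := hU _ _ hxy hyU
    refine ⟨hlen, fun h hh => (hbase h hh).1, hxl, fun z hzp => hU _ _ (hz z hzp) hxU, ?_, ?_⟩
    · intro z hzp
      refine ⟨fun i => left_ne_zero_of_mul (hz z hzp (.inl i)).ne', fun k hk => ?_⟩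
      have h1 := hz z hzp (.inr (.inl (0, ⟨k, hk⟩)))
      have h2 := hz z hzp (.inr (.inl (1, ⟨k, hk⟩)))
      have h3 := hz z hzp (.inr (.inl (2, ⟨k, hk⟩)))
      rw [hrad1, hrad1] at h1
      rw [hrad2, hrad2] at h2
      rw [hrad3, hrad3] at h3
      have i1 := pos_iff_pos_of_mul_pos h1
      have i2 := neg_iff_neg_of_mul_pos h2
      have i3 := neg_iff_neg_of_mul_pos h3
      have habs : ∀ w : Plane, |w.1 - p| < rad k ↔
          0 < w.1 - (p - rad k) ∧ w.1 - (p + rad k) < 0 := by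
        intro w
        rw [abs_lt]
        constructor <;> rintro ⟨_, _⟩ <;> constructor <;> linarith
      refine ⟨sub_ne_zero.1 (left_ne_zero_of_mul h3.ne'), ?_, ?_⟩
      · rwa [sub_neg, sub_neg] at i3
      · rw [habs, habs, i1, i2]
    · intro h hh
      obtain ⟨⟨x1, x2⟩, x3, x4⟩ := hxU
      have h1 := hb h hh (.inr (.inr 0))
      have h2 := hb h hh (.inr (.inr 1))
      have h3 := hb h hh (.inr (.inr 2))
      have h4 := hb h hh (.inr (.inr 3))
      rw [hbox1, hbox1] at h1
      rw [hbox2, hbox2] at h2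
      rw [hbox3, hbox3] at h3
      rw [hbox4, hbox4] at h4
      refine ⟨nonneg_of_mul_nonneg_left h1 x1,
        sub_nonpos.1 (nonpos_of_mul_nonneg_left h2 (sub_neg.2 x2)),
        nonneg_of_mul_nonneg_left h3 x3,
        sub_nonpos.1 (nonpos_of_mul_nonneg_left h4 (sub_neg.2 x4)), fun k hk => ⟨?_, ?_⟩⟩
      · intro hxk
        have h5 := hb h hh (.inr (.inl (2, ⟨k, hk⟩)))
        rw [hrad3, hrad3] at h5
        exact sub_nonpos.1 (nonpos_of_mul_nonneg_left h5 (sub_neg.2 hxk))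
      · intro hxk
        rw [abs_lt] at hxk
        have h5 := hb h hh (.inr (.inl (0, ⟨k, hk⟩)))
        have h6 := hb h hh (.inr (.inl (1, ⟨k, hk⟩)))
        rw [hrad1, hrad1] at h5
        rw [hrad2, hrad2] at h6
        have i5 := nonneg_of_mul_nonneg_left h5 (by simp only; linarith)
        have i6 := nonpos_of_mul_nonneg_left h6 (by simp only; linarith)
        simp only at i5 i6
        rw [abs_le]
        constructor <;> linarith
  · intro W hW hWne hWU
    obtain ⟨l, hl, z, hzW, hz⟩ := hdense W hW hWne hWU
    exact ⟨l, Finset.mem_filter.2 ⟨hl, z, hz⟩, z, hzW, hz⟩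

/-- A copy of the unit square which, inside of the unit square, only shows a neighbourhood of
prescribed size of a point of the bottom side. -/
lemma exists_window {p : ℝ} (hp1 : 1 / 4 ≤ p) (hp2 : p ≤ 3 / 4) (k : ℕ) :
    ∃ g, IsRigidMotion g ∧ (∀ z ∈ g '' UnitSq ∩ UnitSq, Near (p, 0) (4 * rad k) z) ∧
      ∀ z ∈ UnitSq, (k = 0 ∨ (|z.1 - p| < 2 * rad k ∧ z.2 < 2 * rad k)) →
        z ∈ g '' UnitSq := by
  rcases k.eq_zero_or_pos with rfl | hk
  · refine ⟨id, isRigidMotion_id, ?_, fun z hz _ => ⟨z, hz, rfl⟩⟩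
    rintro z ⟨-, ⟨h1, h2⟩, h3, h4⟩
    rw [rad_zero]
    constructor <;> rw [abs_lt] <;> constructor <;> simp only <;> linarith
  · obtain ⟨c, hc⟩ : ∃ c, c = √2 / 2 := ⟨_, rfl⟩
    have hc0 : 0 < c := by
      rw [hc]
      positivity
    have hcc : c * c = 1 / 2 := by
      have := Real.mul_self_sqrt (show (0 : ℝ) ≤ 2 by norm_num)
      rw [hc]
      linarith
    have hc1 : c < 1 := by nlinarith
    obtain ⟨r, hr⟩ : ∃ r, r = rad k := ⟨_, rfl⟩
    have hr0 : 0 < r := hr ▸ rad_pos k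
    have hr1 : r ≤ 1 / 8 := by
      have := rad_antitone (show 1 ≤ k from hk)
      rw [← hr, show 1 = 0 + 1 from rfl, rad_succ, rad_zero] at this
      linarith
    have hcos : Real.cos (-(Real.pi - Real.pi / 4)) = -c := by
      rw [Real.cos_neg, Real.cos_pi_sub, Real.cos_pi_div_four, hc]
    have hsin : Real.sin (-(Real.pi - Real.pi / 4)) = -c := by
      rw [Real.sin_neg, Real.sin_pi_sub, Real.sin_pi_div_four, hc]
    refine ⟨fun z => (p + c * (z.2 - z.1), 4 * r - c * (z.1 + z.2)),
      ⟨-(Real.pi - Real.pi / 4), (p, 4 * r), fun z => ?_⟩, ?_, ?_⟩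
    · rw [hcos, hsin]
      ext <;> simp only <;> ring
    · rintro z ⟨⟨w, ⟨⟨h1, h2⟩, h3, h4⟩, rfl⟩, ⟨h5, h6⟩, h7, h8⟩
      simp only at h5 h6 h7 h8
      rw [← hr]
      have h9 := mul_pos hc0 h1
      have h10 := mul_pos hc0 h3
      constructor <;> rw [abs_lt] <;> constructor <;> simp only <;> linarith
    · rintro z ⟨⟨h1, h2⟩, h3, h4⟩ hz
      obtain ⟨h5, h6⟩ := hz.resolve_left hk.ne'
      rw [← hr] at h5 h6
      rw [abs_lt] at h5
      refine ⟨(c * (4 * r - z.2 - (z.1 - p)), c * (4 * r - z.2 + (z.1 - p))),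
        ⟨⟨?_, ?_⟩, ?_, ?_⟩, ?_⟩
      · exact mul_pos hc0 (by linarith)
      · simp only
        nlinarith
      · exact mul_pos hc0 (by linarith)
      · simp only
        nlinarith
      · ext
        · simp only
          linear_combination 2 * (z.1 - p) * hcc
        · simp only
          linear_combination (-2) * (4 * r - z.2) * hcc

/-- The bottom rectangles used as cutters. -/
lemma isCutter_of_subset {p : ℝ} {T : Set Plane} (hTU : T ⊆ UnitSq) {r : ℝ}
    (hT : ∀ z ∈ UnitSq, |z.1 - p| < r → z.2 < r → z ∈ T) (hp1 : r ≤ p)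
    (hp2 : r ≤ 1 - p) : IsCutter T r := by
  refine ⟨fun z => (z.1 - p, z.2), ⟨0, (-p, 0), fun z => ?_⟩, ?_, ?_⟩
  · rw [Real.cos_zero, Real.sin_zero]
    ext <;> simp only <;> ring
  · rintro w ⟨⟨h1, h2⟩, h3, h4⟩
    refine ⟨(w.1 + p, w.2), hT _ ⟨⟨?_, ?_⟩, ?_, ?_⟩ ?_ ?_, ?_⟩ <;> simp only
    · linarith
    · linarith
    · exact h3
    · linarith
    · rw [abs_lt]
      constructor <;> linarith
    · linarith
    · ext <;> simp
  · rintro w ⟨z, hz, rfl⟩ -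
    exact (hTU hz).2.1

/-- A rectangle whose top side is exposed, used as a cutter upside down. -/
lemma isCutter_of_top {p a : ℝ} {T : Set Plane}
    (hT : ∀ z : Plane, |z.1 - p| < a → a / 2 < z.2 → z.2 < a → z ∈ T)
    (hT' : ∀ z ∈ T, |z.1 - p| < 100 * a → a ≤ z.2 → ¬ z.2 < 101 * a) : IsCutter T a := by
  refine ⟨fun z => (p - z.1, a - z.2), ⟨Real.pi, (p, a), fun z => ?_⟩, ?_, ?_⟩
  · rw [Real.cos_pi, Real.sin_pi]
    ext <;> simp only <;> ring
  · rintro w ⟨⟨h1, h2⟩, h3, h4⟩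
    refine ⟨(p - w.1, a - w.2), hT _ ?_ ?_ ?_, ?_⟩ <;> simp only
    · rw [abs_lt]
      constructor <;> linarith
    · linarith
    · linarith
    · ext <;> simp
  · rintro w ⟨z, hz, rfl⟩ ⟨h1, h2⟩
    by_contra! h3
    simp only [Prod.fst_zero, Prod.snd_zero, sub_zero] at h1 h2 h3
    rw [abs_lt] at h2
    refine hT' z hz ?_ (by linarith) (by linarith)
    rwa [abs_sub_comm]

lemma disjoint_closure_piece {hs : List (Plane × Plane)} {W : Set Plane} (hW : IsOpen W)
    (h : ∀ z ∈ piece hs, z ∉ W) {z : Plane} (hz : z ∈ W) : z ∉ closure (piece hs) := by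
  intro hz'
  obtain ⟨w, hw, hw'⟩ := mem_closure_iff.1 hz' W hW hz
  exact h w hw' hw

lemma IsCutter.turns_remove_piece {T : Set Plane} (hTU : T ⊆ UnitSq) {p : ℝ} (hp1 : 1 / 4 ≤ p)
    (hp2 : p ≤ 3 / 4) (k : ℕ) (hT : IsCutter T (rad k)) (hs : List (Plane × Plane))
    (hlen : hs.length = 3) (hd : ∀ h ∈ hs, h.2 ≠ 0)
    (ho : ∀ h ∈ hs, |h.1.1 - p| ≤ 4 * rad k ∧ |h.1.2| ≤ 4 * rad k) (hU : piece hs ⊆ UnitSq)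
    (hk : k = 0 ∨ ∀ z ∈ piece hs, |z.1 - p| < 2 * rad k ∧ z.2 < 2 * rad k) :
    Turns 1685 T (T \ closure (piece hs)) := by
  obtain ⟨g, hg, hV, hin⟩ := exists_window hp1 hp2 k
  have h := hT.turns_remove hTU (rad_pos k) (p, 0) hg hV hs hd
    (fun h hh => by simpa only [sub_zero] using ho h hh)
  rw [hlen] at h
  have hsub : piece hs ⊆ g '' UnitSq ∩ UnitSq :=
    fun z hz => ⟨hin z (hU hz) (hk.imp id fun h => h z hz), hU hz⟩
  have heq : g '' UnitSq ∩ UnitSq ∩ {z | ∀ h ∈ hs, affineAt h z < 0} = piece hs :=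
    inter_eq_right.2 hsub
  rwa [heq] at h
lemma IsPreconnected.subset_of_disjoint_frontier {X : Type*} [TopologicalSpace X] {E B : Set X}
    (hE : IsPreconnected E) (hB : IsOpen B) (hEB : ∀ v ∈ E, v ∉ frontier B)
    (h : (E ∩ B).Nonempty) : E ⊆ B := by
  refine hE.subset_left_of_subset_union hB (isClosed_closure (s := B)).isOpen_compl
    (disjoint_left.2 fun z hz hz' => hz' (subset_closure hz)) (fun v hv => ?_) h
  by_cases hvB : v ∈ B
  · exact .inl hvB
  · exact .inr fun hvc => hEB v hv (by rw [hB.frontier_eq]; exact ⟨hvc, hvB⟩)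

/-- An open part of the unit square that is bounded by straight lines, and that contains a
suitable rectangle just above the bottom side, can be removed. -/
lemma turns_remove_region {n : ℕ} (hn : 1 ≤ n) (L : Fin n → Plane × Plane)
    (hL : ∀ i, (L i).2 ≠ 0) {B : Set Plane} (hB : IsOpen B) (hBU : B ⊆ UnitSq)
    (hF : ∀ z ∈ frontier B, z ∈ UnitSq → ∃ i, affineAt (L i) z = 0) {p : ℝ} {J : ℕ}
    (hp1 : 1 / 4 ≤ p) (hp2 : p ≤ 3 / 4) (hJ : 1 ≤ J) (hJn : J ≤ 13 * n + 10)
    (hS : ∀ z : Plane, |z.1 - p| < 256 * rad J → rad J / 4 < z.2 → z.2 < 256 * rad J → z ∈ B) :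
    Turns (50000000 * n ^ 2) UnitSq (UnitSq \ closure B) := by
  classical
  obtain ⟨κ, A, hs, x, hcard, hA, hdense⟩ := exists_pieces L hL p (J + 3)
  set E : κ → Set Plane := fun l => piece (hs l) with hE
  set D : ℕ → Set Plane := fun k => {z | |z.1 - p| < rad k ∧ z.2 < rad k} with hD
  have hDo : ∀ k, IsOpen (D k) := by
    intro k
    have h1 : IsOpen {z : Plane | |z.1 - p| < rad k} := isOpen_lt (by fun_prop) (by fun_prop)
    have h2 : IsOpen {z : Plane | z.2 < rad k} := isOpen_lt (by fun_prop) (by fun_prop)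
    exact h1.inter h2
  have hDanti : ∀ {k m}, k ≤ m → D m ⊆ D k := fun hkm z hz =>
    ⟨hz.1.trans_le (rad_antitone hkm), hz.2.trans_le (rad_antitone hkm)⟩
  have hrad4 : ∀ k, rad k ≤ 1 / 4 := fun k => rad_zero ▸ rad_antitone k.zero_le
  have hJ1 : rad (J - 1) = 2 * rad J := by
    obtain ⟨m, rfl⟩ : ∃ m, J = m + 1 := ⟨J - 1, by omega⟩
    rw [rad_succ, Nat.add_sub_cancel]
    ring
  have hJ2 : rad (J + 2) = rad J / 4 := by
    rw [rad_add]
    ring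
  have hJ0 := rad_pos J
  set A₁ := A.filter fun l => E l ⊆ B with hA₁
  have hAD : ∀ l ∈ A, ∀ k < J + 3, ∀ z ∈ E l, (z ∈ D k ↔ x l ∈ D k) := by
    intro l hl k hk z hz
    obtain ⟨-, -, -, -, h, -⟩ := hA l hl
    exact and_congr ((h z hz).2 k hk).2.2 ((h z hz).2 k hk).2.1
  have hcover : ∀ W, IsOpen W → (W ∩ B).Nonempty → ∃ l ∈ A₁, (W ∩ E l).Nonempty := by
    intro W hW hWB
    obtain ⟨l, hl, z, ⟨hzW, hzB⟩, hz⟩ :=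
      hdense (W ∩ B) (hW.inter hB) hWB (inter_subset_right.trans hBU)
    refine ⟨l, Finset.mem_filter.2 ⟨hl, ?_⟩, z, hzW, hz⟩
    obtain ⟨-, -, -, hU, h, -⟩ := hA l hl
    refine (convex_piece (hs l)).isPreconnected.subset_of_disjoint_frontier hB (fun v hv hvB => ?_)
      ⟨z, hz, hzB⟩
    obtain ⟨i, hi⟩ := hF v hvB (hU hv)
    exact (h v hv).1 i hi
  set F : ℕ → Finset κ := fun k => A₁.filter fun l => x l ∉ D k with hFdef
  have hstep : ∀ l ∈ A₁, ∀ k ≤ J, (k = 0 ∨ x l ∈ D (k - 1)) → ∀ T ⊆ UnitSq,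
      IsCutter T (rad k) → Turns 1685 T (T \ closure (E l)) := by
    intro l hl k hk hxk T hTU hT
    obtain ⟨hlA, -⟩ := Finset.mem_filter.1 hl
    obtain ⟨hlen, hd, -, hU, hz, hbase⟩ := hA l hlA
    have hk1 : ∀ k : ℕ, k ≠ 0 → rad (k - 1) = 2 * rad k := by
      intro k hk
      obtain ⟨m, rfl⟩ := Nat.exists_eq_succ_of_ne_zero hk
      rw [Nat.succ_eq_add_one, rad_succ, Nat.add_sub_cancel]
      ring
    refine hT.turns_remove_piece hTU hp1 hp2 k _ hlen hd ?_ hU ?_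
    · intro h hh
      obtain ⟨o1, o2, o3, o4, ho⟩ := hbase h hh
      rw [abs_of_nonneg o3]
      rcases eq_or_ne k 0 with rfl | hk0
      · rw [rad_zero, abs_le]
        refine ⟨⟨?_, ?_⟩, ?_⟩ <;> linarith
      · have hx := hxk.resolve_left hk0
        have h1 := (ho (k - 1) (by omega)).1 hx.2
        have h2 := (ho (k - 1) (by omega)).2 hx.1
        rw [hk1 k hk0] at h1 h2
        have := rad_pos k
        constructor <;> linarith
    · rcases eq_or_ne k 0 with rfl | hk0
      · exact Or.inl rfl
      · refine Or.inr fun z hz' => ?_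
        rw [← hk1 k hk0]
        exact (hAD l hlA (k - 1) (by omega) z hz').2 (hxk.resolve_left hk0)
  have hcl : ∀ l ∈ A, ∀ k < J + 3, x l ∉ D k → ∀ z ∈ D k, z ∉ closure (E l) := by
    intro l hl k hk hxk z hz
    exact disjoint_closure_piece (hDo k) (fun w hw => mt (hAD l hl k hk w hw).1 hxk) hz
  have hphase : ∀ k ≤ J, Turns (1685 * (F k).card) UnitSq
      (UnitSq \ ⋃ l ∈ F k, closure (E l)) := by
    have hgen : ∀ k ≤ J, ∀ G ⊆ F k, (∀ l ∈ G, k = 0 ∨ x l ∈ D (k - 1)) → ∀ T ⊆ UnitSq,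
        (∀ z ∈ UnitSq, |z.1 - p| < rad k → z.2 < rad k → z ∈ T) →
        Turns (1685 * G.card) T (T \ ⋃ l ∈ G, closure (E l)) := by
      intro k hk G hG hGD T hTU hT
      refine (Turns.remove_finset G E 1685 (fun T => T ⊆ UnitSq ∧
        ∀ z ∈ UnitSq, |z.1 - p| < rad k → z.2 < rad k → z ∈ T) ?_ T ⟨hTU, hT⟩).1
      rintro l hl T ⟨hTU, hT⟩
      obtain ⟨hlA, hlx⟩ := Finset.mem_filter.1 (hG hl)
      refine ⟨hstep l hlA k hk (hGD l hl) T hTU (isCutter_of_subset hTU hT ?_ ?_),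
        sdiff_subset.trans hTU, fun z hz h1 h2 => ⟨hT z hz h1 h2, ?_⟩⟩
      · linarith [hrad4 k]
      · linarith [hrad4 k]
      · exact hcl l (Finset.mem_filter.1 hlA).1 k (by omega) hlx z ⟨h1, h2⟩
    intro k
    induction k with
    | zero =>
      intro hk
      exact hgen 0 hk _ subset_rfl (fun l _ => Or.inl rfl) _ subset_rfl fun z hz _ _ => hz
    | succ k ih =>
      intro hk
      have hsub : F k ⊆ F (k + 1) := Finset.monotone_filter_right _
        fun l _ hl hl' => hl (hDanti k.le_succ hl')
      have h1 := ih (by omega)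
      have h2 := hgen (k + 1) hk (F (k + 1) \ F k) Finset.sdiff_subset (fun l hl => by
          obtain ⟨hl1, hl2⟩ := Finset.mem_sdiff.1 hl
          right
          by_contra h
          exact hl2 (Finset.mem_filter.2 ⟨(Finset.mem_filter.1 hl1).1, h⟩))
        (UnitSq \ ⋃ l ∈ F k, closure (E l)) sdiff_subset (fun z hz hz1 hz2 => ⟨hz, by
          simp only [mem_iUnion, not_exists]
          intro l hl
          obtain ⟨hlA, hlx⟩ := Finset.mem_filter.1 (hsub hl)
          exact hcl l (Finset.mem_filter.1 hlA).1 (k + 1) (by omega) hlx z ⟨hz1, hz2⟩⟩)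
      have h3 := h1.trans h2
      rw [← mul_add, add_comm, Finset.card_sdiff_add_card_eq_card hsub, Set.sdiff_sdiff,
        ← Finset.set_biUnion_union, Finset.union_sdiff_of_subset hsub] at h3
      exact h3
  have hclosure : ∀ z ∈ closure B, ∃ l ∈ A₁, z ∈ closure (E l) := by
    intro z hz
    have : z ∈ closure (⋃ l ∈ A₁, E l) := by
      rw [mem_closure_iff]
      intro W hW hzW
      obtain ⟨l, hl, w, hw, hwE⟩ := hcover W hW (mem_closure_iff.1 hz W hW hzW)
      exact ⟨w, hw, mem_biUnion hl hwE⟩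
    rw [Finset.closure_biUnion] at this
    simpa only [mem_iUnion, exists_prop] using this
  have htop : ∀ z : Plane, |z.1 - p| < 100 * rad J → rad J ≤ z.2 → z.2 < 101 * rad J →
      ∃ l ∈ F J, z ∈ closure (E l) := by
    intro z hz1 hz2 hz3
    rw [abs_lt] at hz1
    have : z ∈ closure (⋃ l ∈ F J, E l) := by
      have hzc : z ∈ closure (Ioo (p - 100 * rad J) (p + 100 * rad J) ×ˢ
          Ioo (rad J) (101 * rad J)) := by
        rw [closure_prod_eq, closure_Ioo (by linarith), closure_Ioo (by linarith)]
        exact ⟨⟨by linarith, by linarith⟩, hz2, hz3.le⟩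
      rw [mem_closure_iff]
      intro W hW hzW
      obtain ⟨v, hvW, hv⟩ := mem_closure_iff.1 hzc W hW hzW
      obtain ⟨l, hl, w, ⟨hwW, hw⟩, hwE⟩ := hcover _ (hW.inter (isOpen_Ioo.prod isOpen_Ioo))
        ⟨v, ⟨hvW, hv⟩, hS v (abs_lt.2 ⟨by linarith [hv.1.1], by linarith [hv.1.2]⟩)
          (by linarith [hv.2.1]) (by linarith [hv.2.2])⟩
      refine ⟨w, hwW, mem_biUnion (Finset.mem_filter.2 ⟨hl, fun hx => ?_⟩) hwE⟩
      have := ((hAD l (Finset.mem_filter.1 hl).1 J (by omega) w hwE).2 hx).2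
      exact this.not_gt hw.2.1
    rw [Finset.closure_biUnion] at this
    simpa only [mem_iUnion, exists_prop] using this
  set G := A₁.filter fun l => x l ∈ D J ∧ (x l).2 < rad (J + 2) with hG
  set T := UnitSq \ ⋃ l ∈ F J, closure (E l) with hT
  set Inv : Set Plane → Prop := fun S => S ⊆ T ∧
    ∀ z : Plane, |z.1 - p| < rad J → rad J / 2 < z.2 → z.2 < rad J → z ∈ S with hInv
  have hcutter : ∀ S, Inv S → IsCutter S (rad J) := by
    rintro S ⟨h1, h2⟩
    refine isCutter_of_top h2 fun z hz hz1 hz2 hz3 => ?_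
    obtain ⟨l, hl, hzl⟩ := htop z hz1 hz2 hz3
    exact (h1 hz).2 (mem_biUnion hl hzl)
  have hInvT : Inv T := by
    refine ⟨subset_rfl, fun z h1 h2 h3 => ⟨?_, ?_⟩⟩
    · have := hrad4 J
      rw [abs_lt] at h1
      refine ⟨⟨?_, ?_⟩, ?_, ?_⟩ <;> linarith
    · simp only [mem_iUnion, not_exists]
      intro l hl
      obtain ⟨hlA, hlx⟩ := Finset.mem_filter.1 hl
      exact hcl l (Finset.mem_filter.1 hlA).1 J (by omega) hlx z ⟨h1, h3⟩
  obtain ⟨hturn, hInv'⟩ := Turns.remove_finset G E 1685 Inv (by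
    rintro l hl S hS'
    obtain ⟨hlA, hlx, hlx2⟩ := Finset.mem_filter.1 hl
    refine ⟨hstep l hlA J le_rfl (Or.inr (hDanti (Nat.sub_le _ _) hlx)) S
      (hS'.1.trans sdiff_subset) (hcutter S hS'), sdiff_subset.trans hS'.1,
      fun z h1 h2 h3 => ⟨hS'.2 z h1 h2 h3, ?_⟩⟩
    refine disjoint_closure_piece (W := {w : Plane | rad J / 2 < w.2})
      (isOpen_lt (by fun_prop) (by fun_prop)) (fun w hw hw' => ?_) h2
    obtain ⟨-, -, -, -, hz, -⟩ := hA l (Finset.mem_filter.1 hlA).1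
    have := ((hz w hw).2 (J + 2) (by omega)).2.1.2 hlx2
    rw [hJ2] at this
    have hw'' : rad J / 2 < w.2 := hw'
    linarith) T hInvT
  set T' := T \ ⋃ l ∈ G, closure (E l) with hT'
  obtain ⟨g, hg, hV, hin⟩ := exists_window hp1 hp2 J
  have hlast := (hcutter T' hInv').turns_remove (hInv'.1.trans sdiff_subset) hJ0 (p, 0) hg hV
    [((p, rad J / 4), (0, -1))] (by simp) (by
      intro h hh
      rw [List.mem_singleton.1 hh]
      simp only [sub_self, abs_zero, sub_zero]
      rw [abs_of_pos (by linarith)]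
      constructor <;> linarith)
  have hfinal : T' \ closure (g '' UnitSq ∩ UnitSq ∩
      {z | ∀ h ∈ [(((p, rad J / 4), (0, -1)) : Plane × Plane)], affineAt h z < 0})
      = UnitSq \ closure B := by
    have hset : {z | ∀ h ∈ [(((p, rad J / 4), (0, -1)) : Plane × Plane)], affineAt h z < 0}
        = {z | rad J / 4 < z.2} := by
      ext z
      simp [affineAt]
    rw [hset]
    apply Subset.antisymm
    · rintro z ⟨⟨⟨hzU, hzF⟩, hzG⟩, hzV⟩
      refine ⟨hzU, fun hzB => ?_⟩
      obtain ⟨l, hl, hzl⟩ := hclosure z hzB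
      by_cases hlD : x l ∈ D J
      · by_cases hl2 : (x l).2 < rad (J + 2)
        · exact hzG (mem_biUnion (Finset.mem_filter.2 ⟨hl, hlD, hl2⟩) hzl)
        · refine hzV (closure_mono (fun w hw => ?_) hzl)
          have hlA := (Finset.mem_filter.1 hl).1
          obtain ⟨-, -, -, hU, hz, -⟩ := hA l hlA
          have h1 := (hAD l hlA (J - 1) (by omega) w hw).2 (hDanti (Nat.sub_le _ _) hlD)
          have h2 := (hz w hw).2 (J + 2) (by omega)
          have h3 := lt_of_le_of_ne (not_lt.1 (mt h2.2.1.1 hl2)) h2.1.symm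
          rw [hJ2] at h3
          refine ⟨⟨hin w (hU hw) (Or.inr ?_), hU hw⟩, h3⟩
          rw [← hJ1]
          exact h1
      · exact hzF (mem_biUnion (Finset.mem_filter.2 ⟨hl, hlD⟩) hzl)
    · rintro z ⟨hzU, hzB⟩
      refine ⟨⟨⟨hzU, ?_⟩, ?_⟩, fun hz => hzB (closure_mono ?_ hz)⟩
      · simp only [mem_iUnion, not_exists]
        intro l hl hzl
        exact hzB (closure_mono (Finset.mem_filter.1 (Finset.mem_filter.1 hl).1).2 hzl)
      · simp only [mem_iUnion, not_exists]
        intro l hl hzl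
        exact hzB (closure_mono (Finset.mem_filter.1 (Finset.mem_filter.1 hl).1).2 hzl)
      · rintro w ⟨hw, hw2⟩
        obtain ⟨h1, h2⟩ := hV w hw
        simp only [sub_zero] at h1 h2
        exact hS w (by linarith) hw2 (by linarith [(abs_lt.1 h2).2])
  rw [hfinal] at hlast
  refine (((hphase J le_rfl).trans hturn).trans hlast).mono ?_
  have h1 : (F J).card ≤ A.card :=
    Finset.card_le_card ((Finset.filter_subset _ _).trans (Finset.filter_subset _ _))
  have h2 : G.card ≤ A.card :=
    Finset.card_le_card ((Finset.filter_subset _ _).trans (Finset.filter_subset _ _))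
  have h3 : n + 3 * (J + 3) + 4 ≤ 83 * n := by omega
  have h4 : (n + 3 * (J + 3) + 4) ^ 2 ≤ (83 * n) ^ 2 := Nat.pow_le_pow_left h3 2
  have h5 : 1 ≤ n ^ 2 := Nat.one_le_pow _ _ hn
  rw [mul_pow] at h4
  simp only [List.length_singleton]
  omega

lemma exists_line_of_segment (s : Plane × Plane) :
    ∃ l : Plane × Plane, l.2 ≠ 0 ∧ ∀ z ∈ segment ℝ s.1 s.2, affineAt l z = 0 := by
  obtain ⟨a, b⟩ := s
  by_cases hab : a = b
  · subst hab
    refine ⟨(a, (1, 0)), by simp, fun z hz => ?_⟩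
    rw [segment_same, mem_singleton_iff] at hz
    simp [affineAt, hz]
  · refine ⟨(a, (-(b.2 - a.2), b.1 - a.1)), fun h => hab ?_, ?_⟩
    · simp only [Prod.mk_eq_zero] at h
      exact Prod.ext (by linarith [h.2]) (by linarith [h.1])
    · rintro z ⟨u, v, -, -, huv, rfl⟩
      obtain rfl : u = 1 - v := by linarith
      simp only [affineAt, Prod.fst_add, Prod.snd_add, Prod.smul_fst, Prod.smul_snd, smul_eq_mul]
      ring

lemma UnitSq_diff_closure_diff {P : Set Plane} (hP : P = interior (closure P))
    (hPU : P ⊆ UnitSq) : UnitSq \ closure (UnitSq \ closure P) = P := by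
  have hPo : IsOpen P := by rw [hP]; exact isOpen_interior
  ext z
  constructor
  · rintro ⟨hzU, hz⟩
    rw [hP, mem_interior]
    refine ⟨UnitSq ∩ (closure (UnitSq \ closure P))ᶜ, fun w hw => ?_,
      isOpen_unitSq.inter isClosed_closure.isOpen_compl, hzU, hz⟩
    by_contra hwP
    exact hw.2 (subset_closure ⟨hw.1, hwP⟩)
  · intro hz
    refine ⟨hPU hz, fun hzc => ?_⟩
    obtain ⟨w, hw, -, hwP⟩ := mem_closure_iff.1 hzc P hPo hz
    exact hwP (subset_closure hw)

theorem stmt9 :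
    ∃ C : ℕ, ∀ n : ℕ, 1 ≤ n → ∀ P : Set Plane,
      IsPolygonalDomain P n → P ⊆ UnitSq →
      ∃ k ≤ C * n ^ 2, ∃ T₁ T₂ : Set Plane,
        DReach k (UnitSq, UnitSq) (T₁, T₂) ∧ Realizes T₁ P := by
  refine ⟨50000002, ?_⟩
  rintro n hn P ⟨-, -, hP, s, hs⟩ hPU
  have hPo : IsOpen P := by rw [hP]; exact isOpen_interior
  choose L hL hLs using fun i => exists_line_of_segment (s i)
  have hF : ∀ z ∈ frontier P, ∃ i, affineAt (L i) z = 0 := by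
    intro z hz
    obtain ⟨i, hi⟩ := mem_iUnion.1 (hs hz)
    exact ⟨i, hLs i z hi⟩
  obtain ⟨p, J, hp1, hp2, hJ, hJn, hfree⟩ := exists_free_rectangle L hL
  set S : Set Plane :=
    Ioo (p - 256 * rad J) (p + 256 * rad J) ×ˢ Ioo (rad J / 4) (256 * rad J) with hS
  have hmem : ∀ z : Plane, |z.1 - p| < 256 * rad J → rad J / 4 < z.2 → z.2 < 256 * rad J →
      z ∈ S := by
    intro z h1 h2 h3
    rw [abs_lt] at h1
    exact ⟨⟨by linarith, by linarith⟩, h2, h3⟩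
  have hSfree : ∀ z ∈ S, z ∉ frontier P := by
    rintro z ⟨⟨h1, h2⟩, h3, h4⟩ hz
    obtain ⟨i, hi⟩ := hF z hz
    exact hfree z (abs_lt.2 ⟨by linarith, by linarith⟩) h3 h4 i hi
  have hSU : S ⊆ UnitSq := by
    have h10 : rad J ≤ 1 / 4096 := by
      refine (rad_antitone hJ).trans ?_
      norm_num [rad]
    have h0 := rad_pos J
    rintro z ⟨⟨h1, h2⟩, h3, h4⟩
    exact ⟨⟨by linarith, by linarith⟩, by linarith, by linarith⟩
  have hn2 : 1 ≤ n ^ 2 := Nat.one_le_pow _ _ hn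
  have hself : Realizes P P := ⟨id, isRigidMotion_id, (image_id _).symm⟩
  by_cases hSP : (S ∩ P).Nonempty
  · have hsub : S ⊆ P := ((convex_Ioo _ _).prod (convex_Ioo _ _)).isPreconnected
      |>.subset_of_disjoint_frontier hPo hSfree hSP
    obtain ⟨k, hk, S', hreach⟩ := turns_remove_region hn L hL hPo hPU (fun z hz _ => hF z hz)
      hp1 hp2 (by omega) hJn (fun z h1 h2 h3 => hsub (hmem z h1 h2 h3)) UnitSq
    refine ⟨k + (1 + 1), by omega, _, _, hreach.swap.trans
      ((DStep.reset1 _ _).reach.trans (DStep.snip1 id isRigidMotion_id _ _).reach), ?_⟩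
    rwa [image_id, UnitSq_diff_closure_diff hP hPU]
  · have hQ : IsOpen (UnitSq \ closure P) := isOpen_unitSq.sdiff isClosed_closure
    have hQF : ∀ z ∈ frontier (UnitSq \ closure P), z ∈ UnitSq → ∃ i, affineAt (L i) z = 0 := by
      intro z hz hzU
      rw [hQ.frontier_eq] at hz
      refine hF z ?_
      rw [hPo.frontier_eq]
      refine ⟨by_contra fun h => hz.2 ⟨hzU, h⟩, fun hzP => ?_⟩
      exact ((UnitSq_diff_closure_diff hP hPU).symm.subset hzP).2 hz.1
    have hQS : ∀ z ∈ S, z ∈ UnitSq \ closure P := by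
      refine fun z hz => ⟨hSU hz, fun hc => hSfree z hz ?_⟩
      rw [hPo.frontier_eq]
      exact ⟨hc, fun hzP => hSP ⟨z, hz, hzP⟩⟩
    obtain ⟨k, hk, S', hreach⟩ := turns_remove_region hn L hL hQ sdiff_subset hQF
      hp1 hp2 (by omega) hJn (fun z h1 h2 h3 => hQS z (hmem z h1 h2 h3)) UnitSq
    refine ⟨k, by omega, _, _, hreach, ?_⟩
    rwa [UnitSq_diff_closure_diff hP hPU]
end
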